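/- arXiv:2202.01005 — 4 statements merged into one kernel-verified Lean document; each statement's English description precedes it below -/
import Mathlib

section
/- Fix γ ∈ (−1,1). For each choice of sign, the domain wall w_*^± satisfies the first-order system of ODEs (w_*^±)′(x) = √(1−γ²)·w_*^±(x) ∧ (e₁ ∧ w_*^±(x)) − γ·e₁ ∧ w_*^±(x) for every x ∈ ℝ. -/
open MeasureTheory Filter ENNReal

noncomputable section

abbrev E3 := EuclideanSpace ℝ (Fin 3)

/-- canonical basis vectors of ℝ³ -/
def e1 : E3 := !₂[1, 0, 0]
def e2 : E3 := !₂[0, 1, 0]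
def e3 : E3 := !₂[0, 0, 1]

/-- cross product in ℝ³ -/
def cross3 (a b : E3) : E3 :=
  !₂[a 1 * b 2 - a 2 * b 1, a 2 * b 0 - a 0 * b 2, a 0 * b 1 - a 1 * b 0]

/-- scalar product in ℝ³ -/
def dot3 (a b : E3) : ℝ := a 0 * b 0 + a 1 * b 1 + a 2 * b 2

/-- θ_*(x) = 2 arctan (exp (−√(1−γ²) x)) -/
def thetaStar (γ x : ℝ) : ℝ := 2 * Real.arctan (Real.exp (-Real.sqrt (1 - γ ^ 2) * x))

/-- φ_*(x) = −γ x -/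
def phiStar (γ x : ℝ) : ℝ := -γ * x

/-- the domain walls w_*^± (s = ±1 is the sign) -/
def wStar (γ s x : ℝ) : E3 :=
  !₂[Real.cos (thetaStar γ x),
    s * (Real.sin (thetaStar γ x) * Real.cos (phiStar γ x)),
    s * (Real.sin (thetaStar γ x) * Real.sin (phiStar γ x))]

/-- rotation about the axis e₁ by angle φ -/
def rot (φ : ℝ) (v : E3) : E3 :=
  !₂[v 0, v 1 * Real.cos φ - v 2 * Real.sin φ, v 1 * Real.sin φ + v 2 * Real.cos φ]

/-- the energy gradient δE(m) = −m″ − 2γ e₁ ∧ m′ + m₂e₂ + m₃e₃ -/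
def deltaE (γ : ℝ) (m : ℝ → E3) (x : ℝ) : E3 :=
  -(deriv (deriv m) x) - (2 * γ) • cross3 e1 (deriv m x) + (m x 1) • e2 + (m x 2) • e3

/-- the L² norm of a function on ℝ -/
def L2norm {E : Type*} [NormedAddCommGroup E] (u : ℝ → E) : ℝ :=
  (eLpNorm u 2 volume).toReal

/-- the H¹ norm ‖u‖_{L²} + ‖u′‖_{L²} -/
def H1norm {E : Type*} [NormedAddCommGroup E] [NormedSpace ℝ E] (u : ℝ → E) : ℝ :=
  L2norm u + L2norm (deriv u)

/-- the ℋ¹ seminorm ‖m₂‖_{L²} + ‖m₃‖_{L²} + ‖m′‖_{L²} -/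
def HH1 (m : ℝ → E3) : ℝ :=
  L2norm (fun x => m x 1) + L2norm (fun x => m x 2) + L2norm (deriv m)

/-- the micromagnetic energy E(m) -/
def energy (γ : ℝ) (m : ℝ → E3) : ℝ :=
  (1 / 2) * ∫ x : ℝ,
    (‖deriv m x‖ ^ 2 + 2 * γ * dot3 (deriv m x) (cross3 e1 (m x)) + (1 - (m x 0) ^ 2))

theorem hasDerivAt_E3_of_coords {f : ℝ → E3} {f' : E3} {x : ℝ}
    (h : ∀ i, HasDerivAt (fun y => f y i) (f' i) x) : HasDerivAt f f' x := by
  have h1 : HasDerivAt (fun y => (f y).ofLp) f'.ofLp x := hasDerivAt_pi.2 h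
  exact (PiLp.hasFDerivAt_toLp (𝕜 := ℝ) 2 (f x).ofLp).comp_hasDerivAt x h1

/-- the domain walls w_*^± satisfy the first order ODE system
    (w_*^±)′ = √(1−γ²) w_*^± ∧ (e₁ ∧ w_*^±) − γ e₁ ∧ w_*^±. -/
theorem wStar_ode (γ : ℝ) (hγ : -1 < γ ∧ γ < 1) (s : ℝ) (hs : s = 1 ∨ s = -1) (x : ℝ) :
    deriv (wStar γ s) x =
      Real.sqrt (1 - γ ^ 2) • cross3 (wStar γ s x) (cross3 e1 (wStar γ s x))
        - γ • cross3 e1 (wStar γ s x) := by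
  have hth : HasDerivAt (thetaStar γ)
      (-Real.sqrt (1 - γ ^ 2) * Real.sin (thetaStar γ x)) x := by
    have h0 : HasDerivAt (fun y : ℝ => -Real.sqrt (1 - γ ^ 2) * y)
        (-Real.sqrt (1 - γ ^ 2)) x := by
      simpa using (hasDerivAt_id x).const_mul (-Real.sqrt (1 - γ ^ 2))
    have h1 := (h0.exp.arctan).const_mul 2
    refine h1.congr_deriv ?_
    unfold thetaStar
    rw [Real.sin_two_mul]
    generalize Real.exp (-Real.sqrt (1 - γ ^ 2) * x) = t
    rw [Real.sin_arctan, Real.cos_arctan]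
    have hp : 0 < 1 + t ^ 2 := by positivity
    have hq : Real.sqrt (1 + t ^ 2) * Real.sqrt (1 + t ^ 2) = 1 + t ^ 2 :=
      Real.mul_self_sqrt hp.le
    have hr : t / Real.sqrt (1 + t ^ 2) * (1 / Real.sqrt (1 + t ^ 2)) = t / (1 + t ^ 2) := by
      rw [div_mul_div_comm, hq, mul_one]
    rw [mul_assoc 2, hr]
    field_simp
  have hph : HasDerivAt (phiStar γ) (-γ) x := by
    have h := (hasDerivAt_id x).const_mul (-γ)
    rw [mul_one] at h
    exact h
  have hs2 : s ^ 2 = 1 := by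
    rcases hs with h | h <;> rw [h] <;> norm_num
  apply HasDerivAt.deriv
  apply hasDerivAt_E3_of_coords
  intro i
  have hsc := Real.sin_sq_add_cos_sq (phiStar γ x)
  fin_cases i
  · simp [wStar, cross3, e1]
    refine hth.cos.congr_deriv ?_
    linear_combination (-Real.sqrt (1 - γ ^ 2) * Real.sin (thetaStar γ x) ^ 2) * (s ^ 2 * hsc + hs2)
  · simp [wStar, cross3, e1]
    refine ((hth.sin.mul hph.cos).const_mul s).congr_deriv ?_
    ring
  · simp [wStar, cross3, e1]
    refine ((hth.sin.mul hph.sin).const_mul s).congr_deriv ?_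
    ring
end
end

section
/- Fix γ ∈ (−1,1). For each choice of sign, the energy gradient of the domain wall w_*^± satisfies δE(w_*^±)(x) = 2(1−γ²)·sin²θ_*(x)·w_*^±(x) for every x ∈ ℝ; in particular w_*^±(x) ∧ δE(w_*^±)(x) = 0 for every x, i.e. w_*^± is a critical point of the energy among S²-valued maps. -/
open MeasureTheory Filter ENNReal

noncomputable section

lemma hasDerivAt_vec3 {f g h : ℝ → ℝ} {f' g' h' x : ℝ} (hf : HasDerivAt f f' x)
    (hg : HasDerivAt g g' x) (hh : HasDerivAt h h' x) :
    HasDerivAt (fun y => (!₂[f y, g y, h y] : E3)) (!₂[f', g', h'] : E3) x := by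
  have h0 : HasDerivAt (fun y => ![f y, g y, h y]) ![f', g', h'] x := by
    rw [hasDerivAt_pi]
    intro i
    fin_cases i
    · simpa using hf
    · simpa using hg
    · simpa using hh
  exact ((PiLp.continuousLinearEquiv 2 ℝ (fun _ : Fin 3 => ℝ)).symm.toContinuousLinearMap.hasFDerivAt.comp_hasDerivAt
    x h0)

lemma thetaStar_deriv (γ x : ℝ) :
    HasDerivAt (thetaStar γ) (-Real.sqrt (1 - γ ^ 2) * Real.sin (thetaStar γ x)) x := by
  have h1 : HasDerivAt (fun y : ℝ => -Real.sqrt (1 - γ ^ 2) * y) (-Real.sqrt (1 - γ ^ 2)) x := by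
    simpa using (hasDerivAt_id x).const_mul (-Real.sqrt (1 - γ ^ 2))
  have h2 := (h1.exp.arctan).const_mul 2
  refine h2.congr_deriv ?_
  unfold thetaStar
  rw [Real.sin_two_mul, Real.sin_arctan, Real.cos_arctan]
  set t := Real.exp (-Real.sqrt (1 - γ ^ 2) * x)
  have hp : 0 < 1 + t ^ 2 := by positivity
  have hq : Real.sqrt (1 + t ^ 2) ≠ 0 := (Real.sqrt_pos.2 hp).ne'
  have hs := Real.sq_sqrt hp.le
  have : 2 * (t / Real.sqrt (1 + t ^ 2)) * (1 / Real.sqrt (1 + t ^ 2)) = 2 * t / (1 + t ^ 2) := by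
    field_simp
    rw [hs]
  rw [this]
  field_simp

lemma phiStar_deriv (γ x : ℝ) : HasDerivAt (phiStar γ) (-γ) x := by
  have h : HasDerivAt (fun y : ℝ => -γ * y) (-γ * 1) x := (hasDerivAt_id x).const_mul (-γ)
  rw [mul_one] at h
  exact h

/-- the energy gradient of the domain wall satisfies
    δE(w_*^±) = 2(1−γ²) sin²θ_* · w_*^±, hence w_*^± ∧ δE(w_*^±) = 0. -/
theorem wStar_critical (γ : ℝ) (hγ : -1 < γ ∧ γ < 1) (s : ℝ) (hs : s = 1 ∨ s = -1) (x : ℝ) :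
    deltaE γ (wStar γ s) x
      = (2 * (1 - γ ^ 2) * Real.sin (thetaStar γ x) ^ 2) • wStar γ s x ∧
    cross3 (wStar γ s x) (deltaE γ (wStar γ s) x) = 0 := by
  have key : deltaE γ (wStar γ s) x
      = (2 * (1 - γ ^ 2) * Real.sin (thetaStar γ x) ^ 2) • wStar γ s x := by
    have hk : Real.sqrt (1 - γ ^ 2) ^ 2 = 1 - γ ^ 2 := Real.sq_sqrt (by nlinarith [hγ.1, hγ.2])
    have hθ := thetaStar_deriv γ
    have hφ := phiStar_deriv γ
    have hd1 : deriv (wStar γ s) = fun y => _ := funext fun y =>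
      (hasDerivAt_vec3 (hθ y).cos (((hθ y).sin.mul (hφ y).cos).const_mul s)
        (((hθ y).sin.mul (hφ y).sin).const_mul s)).deriv
    have hcos := (hθ x).cos
    have hsin := (hθ x).sin
    have hcφ := (hφ x).cos
    have hsφ := (hφ x).sin
    have hθ' := hsin.const_mul (-Real.sqrt (1 - γ ^ 2))
    have hd2 := (hasDerivAt_vec3 (hsin.neg.mul hθ')
      ((((hcos.mul hθ').mul hcφ).add (hsin.mul (hsφ.neg.mul_const (-γ)))).const_mul s)
      ((((hcos.mul hθ').mul hsφ).add (hsin.mul (hcφ.mul_const (-γ)))).const_mul s)).deriv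
    have hd2' : deriv (deriv (wStar γ s)) x = _ := (congrArg (fun f => deriv f x) hd1).trans hd2
    unfold deltaE
    rw [hd2', congrFun hd1 x]
    have hcs := Real.sin_sq_add_cos_sq (thetaStar γ x)
    set k := Real.sqrt (1 - γ ^ 2)
    ext i
    fin_cases i
    · simp [cross3, e1, e2, e3, wStar]
      rw [← hk]; ring
    · simp [cross3, e1, e2, e3, wStar]
      generalize Real.sin (thetaStar γ x) = S at *
      generalize Real.cos (thetaStar γ x) = C at *
      have hC : C ^ 2 = 1 - S ^ 2 := by linarith
      ring_nf
      simp only [hk, hC]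
      ring
    · simp [cross3, e1, e2, e3, wStar]
      generalize Real.sin (thetaStar γ x) = S at *
      generalize Real.cos (thetaStar γ x) = C at *
      have hC : C ^ 2 = 1 - S ^ 2 := by linarith
      ring_nf
      simp only [hk, hC]
      ring
  refine ⟨key, ?_⟩
  rw [key]
  ext i
  fin_cases i <;> simp [cross3] <;> ring
end
end

section
/- Fix γ ∈ (−1,1) and let m : ℝ → ℝ³ be twice continuously differentiable with |m(x)| = 1 for all x ∈ ℝ, satisfying: (i) finite energy, i.e. the function x ↦ |m′(x)|² + 2γ m′(x)·(e₁ ∧ m(x)) + (1 − m₁(x)²) is integrable on ℝ; (ii) the criticality equation m(x) ∧ δE(m)(x) = 0 for all x ∈ ℝ; (iii) m(x) → e₁ as x → +∞ and m(x) → −e₁ as x → −∞. Then there exist (y,φ) ∈ ℝ² and a sign s ∈ {+,−} such that m(x) = R_φ w_*^s(x − y) for all x ∈ ℝ. -/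
open MeasureTheory Filter ENNReal

noncomputable section

/-- constancy of a function with vanishing derivative -/
lemma const_of_hasDerivAt_zero (f : ℝ → ℝ) (hf : ∀ x, HasDerivAt f 0 x) (x y : ℝ) :
    f x = f y :=
  is_const_of_deriv_eq_zero (fun x => (hf x).differentiableAt) (fun x => (hf x).deriv) x y

/-- coordinate version of the classification -/
lemma core_classification (γ : ℝ) (hγ : -1 < γ ∧ γ < 1)
    (p b c p1 b1 c1 p2 b2 c2 : ℝ → ℝ)
    (hp : ∀ x, HasDerivAt p (p1 x) x) (hb : ∀ x, HasDerivAt b (b1 x) x)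
    (hc : ∀ x, HasDerivAt c (c1 x) x)
    (hp1 : ∀ x, HasDerivAt p1 (p2 x) x) (hb1 : ∀ x, HasDerivAt b1 (b2 x) x)
    (hc1 : ∀ x, HasDerivAt c1 (c2 x) x)
    (hs : ∀ x, p x ^ 2 + b x ^ 2 + c x ^ 2 = 1)
    (hE : Integrable (fun x => p1 x ^ 2 + b1 x ^ 2 + c1 x ^ 2
      + 2 * γ * (c1 x * b x - b1 x * c x) + (1 - p x ^ 2)))
    (h0 : ∀ x, b x * (-c2 x - 2 * γ * b1 x + c x) - c x * (-b2 x + 2 * γ * c1 x + b x) = 0)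
    (h1 : ∀ x, c x * (-p2 x) - p x * (-c2 x - 2 * γ * b1 x + c x) = 0)
    (h2 : ∀ x, p x * (-b2 x + 2 * γ * c1 x + b x) - b x * (-p2 x) = 0)
    (htop : Tendsto p atTop (nhds 1)) (hbot : Tendsto p atBot (nhds (-1))) :
    ∃ y ψ : ℝ, ∀ x,
      p x = Real.cos (thetaStar γ (x - y)) ∧
      b x = Real.sin (thetaStar γ (x - y)) * Real.cos (ψ - γ * x) ∧
      c x = Real.sin (thetaStar γ (x - y)) * Real.sin (ψ - γ * x) := by
  have hκ2 : 0 < 1 - γ ^ 2 := by nlinarith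
  obtain ⟨κ, hκdef⟩ : ∃ κ, κ = Real.sqrt (1 - γ ^ 2) := ⟨_, rfl⟩
  have hκ : 0 < κ := by rw [hκdef]; exact Real.sqrt_pos.mpr hκ2
  have hκsq : κ ^ 2 = 1 - γ ^ 2 := by rw [hκdef]; exact Real.sq_sqrt hκ2.le
  have horth : ∀ x, p x * p1 x + b x * b1 x + c x * c1 x = 0 := by
    intro x
    have hd : HasDerivAt (fun x => p x ^ 2 + b x ^ 2 + c x ^ 2)
        (2 * p x * p1 x + 2 * b x * b1 x + 2 * c x * c1 x) x := by
      have := (((hp x).pow 2).add ((hb x).pow 2)).add ((hc x).pow 2)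
      refine this.congr_deriv ?_
      norm_num
    have hd2 : HasDerivAt (fun x => p x ^ 2 + b x ^ 2 + c x ^ 2) 0 x := by
      have : (fun x => p x ^ 2 + b x ^ 2 + c x ^ 2) = fun _ => (1 : ℝ) := funext hs
      rw [this]; exact hasDerivAt_const x 1
    have := hd.unique hd2
    linarith
  -- the conserved Hamiltonian
  have hH' : ∀ x, HasDerivAt (fun x => p1 x ^ 2 + (b1 x - γ * c x) ^ 2 + (c1 x + γ * b x) ^ 2
      - κ ^ 2 * (b x ^ 2 + c x ^ 2)) 0 x := by
    intro x
    have := ((((hp1 x).pow 2).add (((hb1 x).sub ((hc x).const_mul γ)).pow 2)).add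
      (((hc1 x).add ((hb x).const_mul γ)).pow 2)).sub
      ((((hb x).pow 2).add ((hc x).pow 2)).const_mul (κ ^ 2))
    refine this.congr_deriv ?_
    have e0 := h0 x
    have e1 := h1 x
    have e2 := h2 x
    have eo := horth x
    have es := hs x
    have key : p1 x * p2 x + b1 x * (b2 x - b x) + c1 x * (c2 x - c x) = 0 := by
      -- δ = (n·δ) n
      obtain ⟨l, hl⟩ : ∃ l, l = p x * (-p2 x) + b x * (-b2 x + 2 * γ * c1 x + b x)
        + c x * (-c2 x - 2 * γ * b1 x + c x) := ⟨_, rfl⟩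
      have d0 : -p2 x = l * p x := by
        rw [hl]; linear_combination (-b x) * e2 + c x * e1 + p2 x * es
      have d1 : (-b2 x + 2 * γ * c1 x + b x) = l * b x := by
        rw [hl]; linear_combination (p x) * e2 - c x * e0 - (-b2 x + 2 * γ * c1 x + b x) * es
      have d2 : (-c2 x - 2 * γ * b1 x + c x) = l * c x := by
        rw [hl]; linear_combination (-p x) * e1 + b x * e0 - (-c2 x - 2 * γ * b1 x + c x) * es
      linear_combination (-p1 x) * d0 - b1 x * d1 - c1 x * d2 - l * eo
    norm_num
    rw [hκsq]
    linear_combination 2 * key - 2 * γ * e0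
  have hHc := const_of_hasDerivAt_zero _ hH'
  have hH : ∀ x, p1 x ^ 2 + (b1 x - γ * c x) ^ 2 + (c1 x + γ * b x) ^ 2
      = κ ^ 2 * (b x ^ 2 + c x ^ 2) := by
    obtain ⟨h, hh⟩ : ∃ h, h = p1 0 ^ 2 + (b1 0 - γ * c 0) ^ 2 + (c1 0 + γ * b 0) ^ 2
      - κ ^ 2 * (b 0 ^ 2 + c 0 ^ 2) := ⟨_, rfl⟩
    have hint : Integrable (fun _ : ℝ => h) := by
      refine Integrable.mono' hE aestronglyMeasurable_const (Eventually.of_forall fun x => ?_)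
      have e := hHc x 0
      simp only [← hh] at e
      have es := hs x
      have hA : p1 x ^ 2 + b1 x ^ 2 + c1 x ^ 2
          + 2 * γ * (c1 x * b x - b1 x * c x) + (1 - p x ^ 2)
          = p1 x ^ 2 + (b1 x - γ * c x) ^ 2 + (c1 x + γ * b x) ^ 2
            + κ ^ 2 * (b x ^ 2 + c x ^ 2) := by
        rw [hκsq]; linear_combination -es
      rw [hA, Real.norm_eq_abs, abs_le, ← e]
      have k1 : 0 ≤ κ ^ 2 * (b x ^ 2 + c x ^ 2) := by positivity
      have k2 : 0 ≤ p1 x ^ 2 + (b1 x - γ * c x) ^ 2 + (c1 x + γ * b x) ^ 2 := by positivity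
      constructor <;> linarith
    have hz : h = 0 := by
      rw [integrable_const_iff] at hint
      rcases hint with hz | hf
      · exact hz
      · have := hf.measure_univ_lt_top
        simp at this
    intro x
    have e := hHc x 0
    simp only [← hh, hz] at e
    linarith
  -- the conserved angular momentum
  have hL' : ∀ x, HasDerivAt (fun x => b x * (c1 x + γ * b x) - c x * (b1 x - γ * c x)) 0 x := by
    intro x
    have := ((hb x).mul ((hc1 x).add ((hb x).const_mul γ))).sub
      ((hc x).mul ((hb1 x).sub ((hc x).const_mul γ)))
    refine this.congr_deriv ?_
    simp only [Pi.add_apply, Pi.sub_apply]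
    linear_combination -(h0 x)
  have hLc := const_of_hasDerivAt_zero _ hL'
  have hf0 : Tendsto (fun x => κ * (b x ^ 2 + c x ^ 2)) atTop (nhds 0) := by
    have : (fun x => κ * (b x ^ 2 + c x ^ 2)) = fun x => κ * (1 - p x ^ 2) := by
      funext x; rw [← hs x]; ring
    rw [this]
    have := (((htop.pow 2).const_sub 1).const_mul κ)
    simpa using this
  have hL : ∀ x, b x * (c1 x + γ * b x) - c x * (b1 x - γ * c x) = 0 := by
    intro x
    have hb0 : ∀ z, (b x * (c1 x + γ * b x) - c x * (b1 x - γ * c x)) ^ 2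
        ≤ (κ * (b z ^ 2 + c z ^ 2)) ^ 2 := by
      intro z
      have e := hLc x z
      rw [e]
      have k : (b z * (c1 z + γ * b z) - c z * (b1 z - γ * c z)) ^ 2
        ≤ (b z ^ 2 + c z ^ 2) * ((b1 z - γ * c z) ^ 2 + (c1 z + γ * b z) ^ 2) := by
        nlinarith [sq_nonneg (b z * (b1 z - γ * c z) + c z * (c1 z + γ * b z))]
      have k2 : (b1 z - γ * c z) ^ 2 + (c1 z + γ * b z) ^ 2 ≤ κ ^ 2 * (b z ^ 2 + c z ^ 2) := by
        nlinarith [hH z, sq_nonneg (p1 z)]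
      have k3 := mul_le_mul_of_nonneg_left k2 (by positivity : 0 ≤ b z ^ 2 + c z ^ 2)
      linarith
    have hle := ge_of_tendsto' (hf0.pow 2) hb0
    have : (b x * (c1 x + γ * b x) - c x * (b1 x - γ * c x)) ^ 2 = 0 := by
      apply le_antisymm _ (sq_nonneg _)
      simpa using hle
    exact pow_eq_zero_iff (two_ne_zero) |>.mp this
  have hsq : ∀ x, p1 x ^ 2 = (κ * (1 - p x ^ 2)) ^ 2 := by
    intro x
    have l := hL x
    have eo := horth x
    have es := hs x
    have eh := hH x
    have k : (b x ^ 2 + c x ^ 2) * ((b1 x - γ * c x) ^ 2 + (c1 x + γ * b x) ^ 2)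
        = (p x * p1 x) ^ 2 := by
      have : b x * (b1 x - γ * c x) + c x * (c1 x + γ * b x) = - (p x * p1 x) := by
        linear_combination eo
      calc _ = (b x * (b1 x - γ * c x) + c x * (c1 x + γ * b x)) ^ 2
          + (b x * (c1 x + γ * b x) - c x * (b1 x - γ * c x)) ^ 2 := by ring
        _ = _ := by rw [this, l]; ring
    have f : 1 - p x ^ 2 = b x ^ 2 + c x ^ 2 := by linarith
    rw [f]
    linear_combination (b x ^ 2 + c x ^ 2) * eh - k - (p1 x) ^ 2 * es
  have hfnn : ∀ x, 0 ≤ 1 - p x ^ 2 := fun x => by nlinarith [hs x, sq_nonneg (b x), sq_nonneg (c x)]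
  have habs : ∀ x, |p1 x| = κ * (1 - p x ^ 2) := by
    intro x
    rw [← Real.sqrt_sq_eq_abs, hsq x, Real.sqrt_sq (mul_nonneg hκ.le (hfnn x))]
  have hple : ∀ x, |p x| ≤ 1 := fun x => by
    rw [← sq_le_one_iff_abs_le_one]; linarith [hfnn x]
  have hfd : ∀ x, HasDerivAt (fun x => 1 - p x ^ 2) (-(2 * p x * p1 x)) x := by
    intro x
    have := ((hp x).pow 2).const_sub 1
    refine this.congr_deriv ?_
    norm_num
  have hfd2 : ∀ x, |2 * p x * p1 x| ≤ 2 * κ * (1 - p x ^ 2) := by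
    intro x
    rw [abs_mul, abs_mul, habs x, abs_two]
    have := mul_le_mul_of_nonneg_right (hple x) (mul_nonneg hκ.le (hfnn x))
    linarith
  have hed : ∀ (k : ℝ) x, HasDerivAt (fun x => Real.exp (k * x)) (Real.exp (k * x) * k) x := by
    intro k x
    simpa using ((hasDerivAt_id x).const_mul k).exp
  have hmono : Monotone (fun x => (1 - p x ^ 2) * Real.exp (2 * κ * x)) := by
    refine monotone_of_hasDerivAt_nonneg (fun x => (hfd x).mul (hed _ x)) (fun x => ?_)
    have := (abs_le.mp (hfd2 x)).2
    have e := Real.exp_pos (2 * κ * x)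
    have : 0 ≤ (-(2 * p x * p1 x) + 2 * κ * (1 - p x ^ 2)) * Real.exp (2 * κ * x) :=
      mul_nonneg (by linarith) e.le
    simp only [Pi.zero_apply]
    linarith
  have hanti : Antitone (fun x => (1 - p x ^ 2) * Real.exp (-(2 * κ) * x)) := by
    refine antitone_of_hasDerivAt_nonpos (fun x => (hfd x).mul (hed _ x)) (fun x => ?_)
    have := (abs_le.mp (hfd2 x)).1
    have e := Real.exp_pos (-(2 * κ) * x)
    have : 0 ≤ ((2 * p x * p1 x) + 2 * κ * (1 - p x ^ 2)) * Real.exp (-(2 * κ) * x) :=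
      mul_nonneg (by linarith) e.le
    simp only [Pi.zero_apply]
    linarith
  have hpc : Continuous p := continuous_iff_continuousAt.mpr fun x => (hp x).continuousAt
  have hp1c : Continuous p1 := continuous_iff_continuousAt.mpr fun x => (hp1 x).continuousAt
  -- a point where p = 0
  obtain ⟨z, hz⟩ : ∃ z, p z = 0 := by
    obtain ⟨x1, hx1⟩ := (htop.eventually (lt_mem_nhds (show (0:ℝ) < 1 by norm_num))).exists
    obtain ⟨x2, hx2⟩ := (hbot.eventually (gt_mem_nhds (show (-1:ℝ) < 0 by norm_num))).exists
    exact mem_range_of_exists_le_of_exists_ge hpc ⟨x2, hx2.le⟩ ⟨x1, hx1.le⟩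
  have hfpos : ∀ x, 0 < 1 - p x ^ 2 := by
    intro x
    rcases le_total z x with h | h
    · have := hmono h
      simp only [hz] at this
      have e := Real.exp_pos (2 * κ * z)
      have e2 := Real.exp_pos (2 * κ * x)
      exact pos_of_mul_pos_left (by linarith) e2.le
    · have := hanti h
      simp only [hz] at this
      have e := Real.exp_pos (-(2 * κ) * z)
      have e2 := Real.exp_pos (-(2 * κ) * x)
      exact pos_of_mul_pos_left (by linarith) e2.le
  have hne : ∀ x, p1 x ≠ 0 := by
    intro x h
    have := habs x
    rw [h, abs_zero] at this
    have := mul_pos hκ (hfpos x)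
    linarith
  have hp1pos : ∀ x, 0 < p1 x := by
    by_contra hcon
    push Not at hcon
    obtain ⟨x0, hx0⟩ := hcon
    have hall : ∀ x, p1 x ≤ 0 := by
      by_contra hcon2
      push Not at hcon2
      obtain ⟨x3, hx3⟩ := hcon2
      obtain ⟨x4, hx4⟩ := mem_range_of_exists_le_of_exists_ge hp1c ⟨x0, hx0⟩ ⟨x3, hx3.le⟩
      exact hne x4 hx4
    have ha : Antitone p := antitone_of_hasDerivAt_nonpos hp hall
    have i1 := ha.le_of_tendsto htop 0
    have i2 := ha.ge_of_tendsto hbot 0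
    linarith
  have hpode : ∀ x, p1 x = κ * (1 - p x ^ 2) := fun x => by
    rw [← habs x, abs_of_pos (hp1pos x)]
  have hlt : ∀ x, 0 < 1 - p x ∧ 0 < 1 + p x := by
    intro x
    have := (abs_lt.mp ((sq_lt_one_iff_abs_lt_one (p x)).mp (by linarith [hfpos x])))
    constructor <;> linarith [this.1, this.2]
  -- explicit form of p; z is the centre since p z = 0
  have hq : ∀ x, HasDerivAt (fun x => (1 + p x) / (1 - p x) * Real.exp (-(2 * κ) * x)) 0 x := by
    intro x
    have := (((hp x).const_add 1).div ((hp x).const_sub 1) (hlt x).1.ne').mul (hed (-(2 * κ)) x)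
    refine this.congr_deriv ?_
    have := (hlt x).1.ne'
    rw [hpode x]
    simp only [Pi.div_apply]
    field_simp
    ring
  have hpx : ∀ x, p x * (Real.exp (κ * (x - z)) + Real.exp (-(κ * (x - z))))
      = Real.exp (κ * (x - z)) - Real.exp (-(κ * (x - z))) := by
    intro x
    have e := const_of_hasDerivAt_zero _ hq x z
    simp only [hz] at e
    have e2 : (1 + p x) * Real.exp (-(κ * (x - z))) = (1 - p x) * Real.exp (κ * (x - z)) := by
      have a1 : Real.exp (-(2 * κ) * z) = Real.exp (-(2 * κ) * x) *
        (Real.exp (κ * (x - z)) * Real.exp (κ * (x - z))) := by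
        rw [← Real.exp_add, ← Real.exp_add]; ring_nf
      have a2 : Real.exp (-(κ * (x - z))) * Real.exp (κ * (x - z)) = 1 := by
        rw [← Real.exp_add]; simp
      rw [a1] at e
      have e1 := Real.exp_pos (-(2 * κ) * x)
      have := (hlt x).1.ne'
      field_simp at e
      have e3 : 1 + p x = (1 - p x) * Real.exp (κ * (x - z)) ^ 2 := by linarith
      rw [e3]
      linear_combination (1 - p x) * Real.exp (κ * (x - z)) * a2
    linarith
  -- the transverse components
  have hB : ∀ x, b1 x - γ * c x = -κ * p x * b x ∧ c1 x + γ * b x = -κ * p x * c x := by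
    intro x
    have l := hL x
    have eo := horth x
    have es := hs x
    have f : b x ^ 2 + c x ^ 2 = 1 - p x ^ 2 := by linarith
    have fp := (hfpos x).ne'
    rw [hpode x] at eo
    constructor
    · apply mul_left_cancel₀ fp
      rw [← f] at eo ⊢
      linear_combination b x * eo - c x * l
    · apply mul_left_cancel₀ fp
      rw [← f] at eo ⊢
      linear_combination c x * eo + b x * l
  have hD : ∀ x, HasDerivAt (fun x => Real.exp (κ * (x - z)) + Real.exp (-(κ * (x - z))))
      (κ * (Real.exp (κ * (x - z)) - Real.exp (-(κ * (x - z))))) x := by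
    intro x
    have i := ((hasDerivAt_id x).sub_const z).const_mul κ
    have := i.exp.add i.neg.exp
    refine this.congr_deriv ?_
    simp
    ring
  have hcos : ∀ x, HasDerivAt (fun x => Real.cos (γ * x)) (-Real.sin (γ * x) * γ) x := by
    intro x
    simpa using ((hasDerivAt_id x).const_mul γ).cos
  have hsin : ∀ x, HasDerivAt (fun x => Real.sin (γ * x)) (Real.cos (γ * x) * γ) x := by
    intro x
    simpa using ((hasDerivAt_id x).const_mul γ).sin
  have hP : ∀ x, HasDerivAt (fun x => (b x * Real.cos (γ * x) - c x * Real.sin (γ * x)) *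
      (Real.exp (κ * (x - z)) + Real.exp (-(κ * (x - z))))) 0 x := by
    intro x
    have := (((hb x).mul (hcos x)).sub ((hc x).mul (hsin x))).mul (hD x)
    refine this.congr_deriv ?_
    have b1e : b1 x = γ * c x - κ * p x * b x := by linarith [(hB x).1]
    have c1e : c1 x = -γ * b x - κ * p x * c x := by linarith [(hB x).2]
    simp only [Pi.mul_apply, Pi.sub_apply]
    rw [← hpx x, b1e, c1e]
    ring
  have hQ : ∀ x, HasDerivAt (fun x => (b x * Real.sin (γ * x) + c x * Real.cos (γ * x)) *
      (Real.exp (κ * (x - z)) + Real.exp (-(κ * (x - z))))) 0 x := by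
    intro x
    have := (((hb x).mul (hsin x)).add ((hc x).mul (hcos x))).mul (hD x)
    refine this.congr_deriv ?_
    have b1e : b1 x = γ * c x - κ * p x * b x := by linarith [(hB x).1]
    have c1e : c1 x = -γ * b x - κ * p x * c x := by linarith [(hB x).2]
    simp only [Pi.mul_apply, Pi.add_apply]
    rw [← hpx x, b1e, c1e]
    ring
  obtain ⟨P, hPd⟩ : ∃ P, P = b z * Real.cos (γ * z) - c z * Real.sin (γ * z) := ⟨_, rfl⟩
  obtain ⟨Q, hQd⟩ : ∃ Q, Q = b z * Real.sin (γ * z) + c z * Real.cos (γ * z) := ⟨_, rfl⟩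
  have hPQ : P ^ 2 + Q ^ 2 = 1 := by
    have es := hs z
    rw [hz] at es
    rw [hPd, hQd]
    linear_combination es + (b z ^ 2 + c z ^ 2) * Real.sin_sq_add_cos_sq (γ * z)
  obtain ⟨ψ, hψ1, hψ2⟩ : ∃ ψ, Real.cos ψ = P ∧ Real.sin ψ = Q := by
    have hn : ‖(⟨P, Q⟩ : ℂ)‖ = 1 := by
      rw [Complex.norm_def, Complex.normSq_mk, Real.sqrt_eq_one]; linarith
    have hn0 : (⟨P, Q⟩ : ℂ) ≠ 0 := by
      intro h; rw [h] at hn; simp at hn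
    refine ⟨Complex.arg ⟨P, Q⟩, ?_, ?_⟩
    · rw [Complex.cos_arg hn0, hn]; simp
    · rw [Complex.sin_arg, hn]; simp
  refine ⟨z, ψ, fun x => ?_⟩
  obtain ⟨t, ht⟩ : ∃ t, t = Real.exp (-(κ * (x - z))) := ⟨_, rfl⟩
  have htp : 0 < t := by rw [ht]; exact Real.exp_pos _
  have hti : Real.exp (κ * (x - z)) = t⁻¹ := by rw [ht, Real.exp_neg, inv_inv]
  have hth : thetaStar γ (x - z) = 2 * Real.arctan t := by
    rw [thetaStar, ← hκdef, ht]; ring_nf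
  have hsq1 : 0 < 1 + t ^ 2 := by positivity
  have hct : Real.cos (thetaStar γ (x - z)) = (1 - t ^ 2) / (1 + t ^ 2) := by
    rw [hth, Real.cos_two_mul, Real.cos_sq_arctan]
    field_simp; ring
  have hst : Real.sin (thetaStar γ (x - z)) = 2 * t / (1 + t ^ 2) := by
    rw [hth, Real.sin_two_mul, Real.sin_arctan, Real.cos_arctan]
    have := Real.sq_sqrt hsq1.le
    have h3 : 0 < Real.sqrt (1 + t ^ 2) := Real.sqrt_pos.mpr hsq1
    field_simp
    rw [this]
  have e1 := hpx x
  have eP := const_of_hasDerivAt_zero _ hP x z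
  have eQ := const_of_hasDerivAt_zero _ hQ x z
  simp only [← hPd, ← hQd, sub_self, mul_zero, neg_zero, Real.exp_zero] at eP eQ
  rw [hti, ← ht] at e1 eP eQ
  have hbc := Real.sin_sq_add_cos_sq (γ * x)
  have eP2 : (b x * Real.cos (γ * x) - c x * Real.sin (γ * x)) * (1 + t ^ 2) = 2 * t * P := by
    field_simp at eP; linarith
  have eQ2 : (b x * Real.sin (γ * x) + c x * Real.cos (γ * x)) * (1 + t ^ 2) = 2 * t * Q := by
    field_simp at eQ; linarith
  rw [hct, hst, Real.cos_sub, Real.sin_sub, hψ1, hψ2]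
  refine ⟨?_, ?_, ?_⟩
  · rw [eq_div_iff hsq1.ne']
    field_simp at e1; linarith
  · rw [div_mul_eq_mul_div, eq_div_iff hsq1.ne']
    linear_combination Real.cos (γ * x) * eP2 + Real.sin (γ * x) * eQ2 - b x * (1 + t ^ 2) * hbc
  · rw [div_mul_eq_mul_div, eq_div_iff hsq1.ne']
    linear_combination -Real.sin (γ * x) * eP2 + Real.cos (γ * x) * eQ2 - c x * (1 + t ^ 2) * hbc

/-- classification of finite-energy critical points connecting −e₁ to e₁:
    they are exactly the translated and rotated domain walls. -/
theorem domain_wall_classification (γ : ℝ) (hγ : -1 < γ ∧ γ < 1)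
    (m : ℝ → E3) (hreg : ContDiff ℝ 2 m) (hsph : ∀ x, ‖m x‖ = 1)
    (hE : Integrable (fun x =>
      ‖deriv m x‖ ^ 2 + 2 * γ * dot3 (deriv m x) (cross3 e1 (m x)) + (1 - (m x 0) ^ 2)))
    (hcrit : ∀ x, cross3 (m x) (deltaE γ m x) = 0)
    (htop : Tendsto m atTop (nhds e1))
    (hbot : Tendsto m atBot (nhds (-e1))) :
    ∃ y φ s : ℝ, (s = 1 ∨ s = -1) ∧ ∀ x, m x = rot φ (wStar γ s (x - y)) := by
  have hd1 : ∀ x, HasDerivAt m (deriv m x) x := fun x =>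
    (hreg.differentiable (by norm_num) x).hasDerivAt
  have hreg1 : ContDiff ℝ 1 (deriv m) := by
    have : ContDiff ℝ (1 + 1) m := by norm_num; exact hreg
    exact (contDiff_succ_iff_deriv.mp this).2.2
  have hd2 : ∀ x, HasDerivAt (deriv m) (deriv (deriv m) x) x := fun x =>
    (hreg1.differentiable (by norm_num) x).hasDerivAt
  have hc1 : ∀ (i : Fin 3) x, HasDerivAt (fun x => m x i) (deriv m x i) x := fun i x =>
    ((EuclideanSpace.proj (𝕜 := ℝ) i).hasFDerivAt.comp_hasDerivAt x (hd1 x))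
  have hc2 : ∀ (i : Fin 3) x, HasDerivAt (fun x => deriv m x i) (deriv (deriv m) x i) x :=
    fun i x => ((EuclideanSpace.proj (𝕜 := ℝ) i).hasFDerivAt.comp_hasDerivAt x (hd2 x))
  have hlim : ∀ (l : Filter ℝ) (v : E3), Tendsto m l (nhds v) →
      Tendsto (fun x => m x 0) l (nhds (v 0)) := fun l v h =>
    ((EuclideanSpace.proj (𝕜 := ℝ) (0 : Fin 3)).continuous.tendsto v).comp h
  have hcr : ∀ (i : Fin 3) x, cross3 (m x) (deltaE γ m x) i = 0 := fun i x => by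
    rw [hcrit x]; rfl
  obtain ⟨y, ψ, h⟩ := core_classification γ hγ (fun x => m x 0) (fun x => m x 1) (fun x => m x 2)
    (fun x => deriv m x 0) (fun x => deriv m x 1) (fun x => deriv m x 2)
    (fun x => deriv (deriv m) x 0) (fun x => deriv (deriv m) x 1) (fun x => deriv (deriv m) x 2)
    (hc1 0) (hc1 1) (hc1 2) (hc2 0) (hc2 1) (hc2 2)
    (by
      intro x
      have h1 : ‖m x‖ ^ 2 = 1 := by rw [hsph x]; norm_num
      rw [EuclideanSpace.norm_sq_eq, Fin.sum_univ_three] at h1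
      simpa using h1)
    (by
      refine hE.congr (Eventually.of_forall fun x => ?_)
      simp only [EuclideanSpace.norm_sq_eq, Fin.sum_univ_three, dot3, cross3, e1]
      simp
      left
      ring)
    (by
      intro x
      have := hcr 0 x
      simp [cross3, deltaE, e1, e2, e3] at this
      linarith)
    (by
      intro x
      have := hcr 1 x
      simp [cross3, deltaE, e1, e2, e3] at this
      linarith)
    (by
      intro x
      have := hcr 2 x
      simp [cross3, deltaE, e1, e2, e3] at this
      linarith)
    (by simpa [e1] using hlim _ _ htop)
    (by simpa [e1] using hlim _ _ hbot)
  refine ⟨y, ψ - γ * y, 1, Or.inl rfl, fun x => ?_⟩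
  obtain ⟨ha, hb, hc⟩ := h x
  have harg : ψ - γ * x = phiStar γ (x - y) + (ψ - γ * y) := by rw [phiStar]; ring
  rw [harg] at hb hc
  rw [Real.cos_add] at hb
  rw [Real.sin_add] at hc
  ext i
  fin_cases i
  · simpa [rot, wStar] using ha
  · simp [rot, wStar]
    rw [hb]; ring
  · simp [rot, wStar]
    rw [hc]; ring
end
end

section
/- Fix γ ∈ (−1,1) and let w_* be one of the two domain walls w_*^±. There exist δ₁ > 0 and C₁ ≥ 1 such that the following holds: for every continuously differentiable w : ℝ → ℝ³ with |w(x)| = 1 for all x, w − w_* ∈ L², (w − w_*)′ ∈ L² and ‖w − w_*‖_{H¹} ≤ δ₁, there exists a gauge g = (y,φ) ∈ ℝ² such that the map ε(x) := R_{−φ} w(x+y) − w_*(x) satisfies: 2ε(x)·w_*(x) + |ε(x)|² = 0 for all x ∈ ℝ; the two orthogonality conditions ∫_ℝ ε·w_*′ dx = 0 and ∫_ℝ ε·(e₁ ∧ w_*) dx = 0; and the bound |g| + ‖ε‖_{H¹} ≤ C₁·‖w − w_*‖_{H¹}. Moreover g is the unique element of ℝ² satisfying these orthogonality conditions together with this bound.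 -/
open MeasureTheory Filter ENNReal

noncomputable section

/-! ### Linear algebra in ℝ³ -/

lemma dot3_eq_inner (a b : E3) : dot3 a b = inner ℝ a b := by
  simp [dot3, PiLp.inner_apply, Fin.sum_univ_three]; ring

lemma norm_sq_E3 (a : E3) : ‖a‖ ^ 2 = a 0 ^ 2 + a 1 ^ 2 + a 2 ^ 2 := by
  simp [EuclideanSpace.norm_sq_eq, Fin.sum_univ_three]

lemma norm_le_E3 (a : E3) : ‖a‖ ≤ |a 0| + |a 1| + |a 2| := by
  refine le_of_sq_le_sq ?_ (by positivity)
  rw [norm_sq_E3, ← sq_abs (a 0), ← sq_abs (a 1), ← sq_abs (a 2)]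
  nlinarith [abs_nonneg (a 0), abs_nonneg (a 1), abs_nonneg (a 2),
    mul_nonneg (abs_nonneg (a 0)) (abs_nonneg (a 1)),
    mul_nonneg (abs_nonneg (a 0)) (abs_nonneg (a 2)),
    mul_nonneg (abs_nonneg (a 1)) (abs_nonneg (a 2))]

lemma hasDerivAt_E3 {f : ℝ → E3} {f' : E3} {x : ℝ}
    (h : ∀ i, HasDerivAt (fun x => f x i) (f' i) x) : HasDerivAt f f' x := by
  have h1 : HasDerivAt (fun x => (EuclideanSpace.equiv (Fin 3) ℝ) (f x))
      ((EuclideanSpace.equiv (Fin 3) ℝ) f') x := hasDerivAt_pi.2 h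
  have h2 := (EuclideanSpace.equiv (Fin 3) ℝ).symm.toContinuousLinearMap.hasFDerivAt.comp_hasDerivAt x h1
  simpa [Function.comp_def] using h2

def linP : E3 →L[ℝ] E3 := LinearMap.toContinuousLinearMap
  { toFun := fun v => !₂[v 0, 0, 0]
    map_add' := by intro a b; ext i; fin_cases i <;> simp
    map_smul' := by intro a b; ext i; fin_cases i <;> simp }

def linQ : E3 →L[ℝ] E3 := LinearMap.toContinuousLinearMap
  { toFun := fun v => !₂[0, v 1, v 2]
    map_add' := by intro a b; ext i; fin_cases i <;> simp
    map_smul' := by intro a b; ext i; fin_cases i <;> simp }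

def linJ : E3 →L[ℝ] E3 := LinearMap.toContinuousLinearMap
  { toFun := fun v => !₂[0, -v 2, v 1]
    map_add' := by intro a b; ext i; fin_cases i <;> simp [add_comm]
    map_smul' := by intro a b; ext i; fin_cases i <;> simp }

lemma linP_apply (v : E3) : linP v = !₂[v 0, 0, 0] := rfl
lemma linQ_apply (v : E3) : linQ v = !₂[0, v 1, v 2] := rfl
lemma linJ_apply (v : E3) : linJ v = !₂[0, -v 2, v 1] := rfl

def rotL (φ : ℝ) : E3 →L[ℝ] E3 := linP + Real.cos φ • linQ + Real.sin φ • linJ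

lemma rotL_apply (φ : ℝ) (v : E3) :
    rotL φ v = linP v + Real.cos φ • linQ v + Real.sin φ • linJ v := rfl

lemma rot_eq (φ : ℝ) (v : E3) : rot φ v = rotL φ v := by
  rw [rotL_apply, linP_apply, linQ_apply, linJ_apply]
  ext i; fin_cases i <;> simp [rot] <;> ring

lemma linPQ (v : E3) : linP v + linQ v = v := by
  rw [linP_apply, linQ_apply]
  ext i; fin_cases i <;> simp

lemma cross_e1 (v : E3) : cross3 e1 v = linJ v := by
  rw [linJ_apply]
  ext i; fin_cases i <;> simp [cross3, e1]

lemma norm_rot (φ : ℝ) (v : E3) : ‖rot φ v‖ = ‖v‖ := by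
  have : ‖rot φ v‖ ^ 2 = ‖v‖ ^ 2 := by
    rw [norm_sq_E3, norm_sq_E3]
    simp [rot]
    nlinarith [Real.sin_sq_add_cos_sq φ]
  exact (sq_eq_sq₀ (norm_nonneg _) (norm_nonneg _)).1 this

lemma norm_rotL (φ : ℝ) (v : E3) : ‖rotL φ v‖ = ‖v‖ := by
  rw [← rot_eq, norm_rot]

lemma inner_rot_neg (φ : ℝ) (a b : E3) :
    inner ℝ (rot (-φ) a) b = inner ℝ a (rot φ b) := by
  rw [← dot3_eq_inner, ← dot3_eq_inner]
  simp [dot3, rot]; ring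

lemma inner_linJ (a b : E3) : inner ℝ a (linJ b) = - inner ℝ (linJ a) b := by
  rw [← dot3_eq_inner, ← dot3_eq_inner, linJ_apply, linJ_apply]
  simp [dot3]

lemma norm_linQ_le (v : E3) : ‖linQ v‖ ≤ ‖v‖ := by
  refine le_of_sq_le_sq ?_ (by positivity)
  rw [norm_sq_E3, norm_sq_E3, linQ_apply]
  simp; nlinarith [sq_nonneg (v 0)]

lemma norm_linP_le (v : E3) : ‖linP v‖ ≤ ‖v‖ := by
  refine le_of_sq_le_sq ?_ (by positivity)
  rw [norm_sq_E3, norm_sq_E3, linP_apply]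
  simp; nlinarith [sq_nonneg (v 1), sq_nonneg (v 2)]

lemma norm_linJ_eq (v : E3) : ‖linJ v‖ = ‖linQ v‖ := by
  have : ‖linJ v‖ ^ 2 = ‖linQ v‖ ^ 2 := by
    rw [norm_sq_E3, norm_sq_E3, linQ_apply, linJ_apply]
    simp; ring
  exact (sq_eq_sq₀ (norm_nonneg _) (norm_nonneg _)).1 this

lemma norm_linJ_le (v : E3) : ‖linJ v‖ ≤ ‖v‖ := by
  rw [norm_linJ_eq]; exact norm_linQ_le v

lemma rot_sub_le (φ : ℝ) (v : E3) : ‖rotL φ v - v‖ ≤ 2 * |φ| * ‖linQ v‖ := by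
  have h : rotL φ v - v = (Real.cos φ - 1) • linQ v + Real.sin φ • linJ v := by
    rw [rotL_apply]; nth_rewrite 4 [← linPQ v]; module
  have h1 : |Real.cos φ - 1| ≤ |φ| := by
    have := Real.abs_cos_sub_cos_le φ 0
    simpa using this
  have h2 : |Real.sin φ| ≤ |φ| := Real.abs_sin_le_abs
  rw [h]
  calc _ ≤ ‖(Real.cos φ - 1) • linQ v‖ + ‖Real.sin φ • linJ v‖ := norm_add_le _ _
    _ = |Real.cos φ - 1| * ‖linQ v‖ + |Real.sin φ| * ‖linQ v‖ := by
      rw [norm_smul, norm_smul, norm_linJ_eq, Real.norm_eq_abs, Real.norm_eq_abs]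
    _ ≤ |φ| * ‖linQ v‖ + |φ| * ‖linQ v‖ := by gcongr
    _ = _ := by ring

/-! ### Exponentially decaying functions -/

def rho (k x : ℝ) : ℝ := Real.exp (-(k * |x|))

lemma rho_pos (k x : ℝ) : 0 < rho k x := Real.exp_pos _

lemma rho_cont (k : ℝ) : Continuous (rho k) := by unfold rho; fun_prop

lemma rho_integrable {k : ℝ} (hk : 0 < k) : Integrable (rho k) := by
  rw [← integrableOn_univ, ← Set.Iic_union_Ioi (a := (0:ℝ)), integrableOn_union]
  constructor
  · refine (integrableOn_exp_mul_Iic hk 0).congr_fun (fun x hx => ?_) measurableSet_Iic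
    simp only [Set.mem_Iic] at hx
    simp [rho, abs_of_nonpos hx]
  · refine (integrableOn_exp_mul_Ioi (neg_neg_of_pos hk) 0).congr_fun (fun x hx => ?_) measurableSet_Ioi
    simp only [Set.mem_Ioi] at hx
    simp [rho, abs_of_pos hx]

lemma rho_memLp {k : ℝ} (hk : 0 < k) : MemLp (rho k) 2 volume := by
  rw [memLp_two_iff_integrable_sq (rho_cont k).aestronglyMeasurable]
  refine (rho_integrable (k := 2 * k) (by positivity)).congr (Eventually.of_forall fun x => ?_)
  simp only [rho]
  rw [← Real.exp_nat_mul]; congr 1; push_cast; ring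

lemma rho_shift {k : ℝ} (hk : 0 < k) (z y : ℝ) :
    rho k (z - y) ≤ Real.exp (k * |y|) * rho k z := by
  unfold rho
  rw [← Real.exp_add, Real.exp_le_exp]
  have := abs_sub_abs_le_abs_sub z y
  nlinarith

/-- continuous with exponential decay -/
structure Dec (k C : ℝ) (S : ℝ → E3) : Prop where
  cont : Continuous S
  bound : ∀ x, ‖S x‖ ≤ C * rho k x

lemma Dec.nonneg {k C : ℝ} {S : ℝ → E3} (h : Dec k C S) : 0 ≤ C := by
  have h1 := h.bound 0
  have h2 := rho_pos k 0
  have h3 := norm_nonneg (S 0)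
  by_contra hc
  push Not at hc
  nlinarith

lemma Dec.comp {k C : ℝ} {S : ℝ → E3} (h : Dec k C S) (L : E3 →L[ℝ] E3) (hL : ∀ v, ‖L v‖ ≤ ‖v‖) :
    Dec k C (fun x => L (S x)) :=
  ⟨L.continuous.comp h.cont, fun x => (hL _).trans (h.bound x)⟩

lemma Dec.add {k C D : ℝ} {S T : ℝ → E3} (h : Dec k C S) (h' : Dec k D T) :
    Dec k (C + D) (fun x => S x + T x) :=
  ⟨h.cont.add h'.cont, fun x => (norm_add_le _ _).trans (by
    have := h.bound x; have := h'.bound x; linarith)⟩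

lemma Dec.smul {k C : ℝ} {S : ℝ → E3} (h : Dec k C S) (a : ℝ) :
    Dec k (|a| * C) (fun x => a • S x) :=
  ⟨h.cont.const_smul a, fun x => by
    rw [norm_smul, Real.norm_eq_abs, mul_assoc]
    exact mul_le_mul_of_nonneg_left (h.bound x) (abs_nonneg a)⟩

lemma Dec.mono {k C D : ℝ} {S : ℝ → E3} (h : Dec k C S) (hCD : C ≤ D) : Dec k D S :=
  ⟨h.cont, fun x => (h.bound x).trans (mul_le_mul_of_nonneg_right hCD (rho_pos k x).le)⟩

lemma Dec.memLp {k C : ℝ} (hk : 0 < k) {S : ℝ → E3} (h : Dec k C S) : MemLp S 2 volume :=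
  ((rho_memLp hk).const_mul C).mono' h.cont.aestronglyMeasurable (Eventually.of_forall h.bound)

lemma L2norm_nonneg {E : Type*} [NormedAddCommGroup E] (u : ℝ → E) : 0 ≤ L2norm u :=
  ENNReal.toReal_nonneg

lemma H1norm_nonneg {E : Type*} [NormedAddCommGroup E] [NormedSpace ℝ E] (u : ℝ → E) :
    0 ≤ H1norm u := add_nonneg (L2norm_nonneg _) (L2norm_nonneg _)

lemma L2norm_le_of_bound {k C : ℝ} (hk : 0 < k) (hC : 0 ≤ C) {S : ℝ → E3}
    (h : ∀ x, ‖S x‖ ≤ C * rho k x) : L2norm S ≤ C * L2norm (rho k) := by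
  unfold L2norm
  have h1 : eLpNorm S 2 volume ≤ ENNReal.ofReal C * eLpNorm (rho k) 2 volume := by
    apply eLpNorm_le_mul_eLpNorm_of_ae_le_mul
    refine Eventually.of_forall fun x => ?_
    rw [Real.norm_of_nonneg (rho_pos k x).le]; exact h x
  have h2 := (rho_memLp hk).eLpNorm_ne_top
  have := ENNReal.toReal_mono (ENNReal.mul_ne_top ENNReal.ofReal_ne_top h2) h1
  rwa [ENNReal.toReal_mul, ENNReal.toReal_ofReal hC] at this

lemma L2norm_add_le {u v : ℝ → E3} (hu : MemLp u 2 volume) (hv : MemLp v 2 volume) :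
    L2norm (fun x => u x + v x) ≤ L2norm u + L2norm v := by
  unfold L2norm
  rw [← ENNReal.toReal_add hu.eLpNorm_ne_top hv.eLpNorm_ne_top]
  exact ENNReal.toReal_mono (ENNReal.add_ne_top.2 ⟨hu.eLpNorm_ne_top, hv.eLpNorm_ne_top⟩)
    (eLpNorm_add_le hu.1 hv.1 (by norm_num))

lemma abs_integral_inner_le {u v : ℝ → E3} (hu : MemLp u 2 volume) (hv : MemLp v 2 volume) :
    |∫ x, inner ℝ (u x) (v x)| ≤ L2norm u * L2norm v := by
  have h1 : ∫ x, inner ℝ (u x) (v x) = inner ℝ (hu.toLp u) (hv.toLp v) := by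
    rw [L2.inner_def]
    apply integral_congr_ae
    filter_upwards [hu.coeFn_toLp, hv.coeFn_toLp] with x h1 h2
    rw [h1, h2]
  rw [h1]
  have := abs_real_inner_le_norm (hu.toLp u) (hv.toLp v)
  rwa [Lp.norm_toLp, Lp.norm_toLp] at this

lemma memLp_shift {u : ℝ → E3} (hu : MemLp u 2 volume) (y : ℝ) :
    MemLp (fun x => u (x + y)) 2 volume :=
  hu.comp_measurePreserving (measurePreserving_add_right volume y)

lemma L2norm_shift {u : ℝ → E3} (hu : MemLp u 2 volume) (y : ℝ) :
    L2norm (fun x => u (x + y)) = L2norm u := by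
  unfold L2norm
  congr 1
  exact eLpNorm_comp_measurePreserving hu.1 (measurePreserving_add_right volume y)

/-! ### The functional `y ↦ ∫ ⟨w, S(·-y)⟩` -/

def bq (w S : ℝ → E3) (y : ℝ) : ℝ := ∫ z, inner ℝ (w z) (S (z - y))

lemma bq_integrable {k C D : ℝ} (hk : 0 < k) {w S : ℝ → E3} (hw : Continuous w)
    (hwb : ∀ x, ‖w x‖ ≤ D) (hS : Dec k C S) (y : ℝ) :
    Integrable (fun z => inner ℝ (w z) (S (z - y))) := by
  have hS' := hS.cont
  refine Integrable.mono' (g := fun z => D * (C * rho k (z - y))) ?_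
    (by exact Continuous.aestronglyMeasurable (by fun_prop)) (Eventually.of_forall fun z => ?_)
  · exact (((rho_integrable hk).comp_sub_right y).const_mul C).const_mul D
  · refine (norm_inner_le_norm _ _).trans ?_
    have := hS.bound (z - y)
    have := hwb z
    gcongr
    exact (norm_nonneg _).trans this

lemma bq_shift (w S : ℝ → E3) (y : ℝ) : bq w S y = ∫ x, inner ℝ (w (x + y)) (S x) := by
  unfold bq
  rw [← integral_add_right_eq_self _ y]
  simp

lemma bq_hasDerivAt {k C D : ℝ} (hk : 0 < k) {w S S' : ℝ → E3} (hw : Continuous w)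
    (hwb : ∀ x, ‖w x‖ ≤ D) (hS : Dec k C S) (hS' : Dec k C S')
    (hd : ∀ x, HasDerivAt S (S' x) x) (y : ℝ) :
    HasDerivAt (bq w S) (-bq w S' y) y := by
  have hC := hS.nonneg
  have hD : 0 ≤ D := (norm_nonneg _).trans (hwb 0)
  have hSc := hS.cont
  have hSc' := hS'.cont
  have := (hasDerivAt_integral_of_dominated_loc_of_deriv_le (μ := volume)
    (F := fun y z => inner ℝ (w z) (S (z - y)))
    (F' := fun y z => - inner ℝ (w z) (S' (z - y)))
    (bound := fun z => D * (C * (Real.exp (k * (|y| + 1)) * rho k z)))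
    (x₀ := y) (Metric.ball_mem_nhds y one_pos)
    (Eventually.of_forall fun y => Continuous.aestronglyMeasurable (by fun_prop))
    (bq_integrable hk hw hwb hS y)
    (Continuous.aestronglyMeasurable (by fun_prop))
    (Eventually.of_forall fun z y' hy' => ?_)
    ((((rho_integrable hk).const_mul _).const_mul C).const_mul D)
    (Eventually.of_forall fun z y' hy' => ?_)).2
  · rw [integral_neg] at this
    exact this
  · rw [norm_neg]
    refine (norm_inner_le_norm _ _).trans ?_
    have h1 := hS'.bound (z - y')
    have h2 := hwb z
    have h3 := rho_shift hk z y'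
    have h4 : |y'| ≤ |y| + 1 := by
      rw [Metric.mem_ball, Real.dist_eq] at hy'
      have := abs_sub_abs_le_abs_sub y' y
      linarith
    refine mul_le_mul h2 (h1.trans ?_) (norm_nonneg _) hD
    refine mul_le_mul_of_nonneg_left (h3.trans ?_) hC
    have := (rho_pos k z).le
    gcongr
  · have h1 : HasDerivAt (fun y' => S (z - y')) (-S' (z - y')) y' := by
      have := (hd (z - y')).scomp y' ((hasDerivAt_id y').const_sub z)
      simpa [Function.comp_def] using this
    have := (hasDerivAt_const y' (w z)).inner ℝ h1
    simpa using this

lemma bq_continuous {k C D : ℝ} (hk : 0 < k) {w S : ℝ → E3} (hw : Continuous w)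
    (hwb : ∀ x, ‖w x‖ ≤ D) (hS : Dec k C S) : Continuous (bq w S) := by
  have hSc := hS.cont
  have : bq w S = fun y => ∫ x, inner ℝ (w (x + y)) (S x) := funext (bq_shift w S)
  rw [this]
  refine continuous_of_dominated (bound := fun z => D * (C * rho k z)) (fun y => ?_) (fun y => ?_) ?_ ?_
  · exact Continuous.aestronglyMeasurable (by fun_prop)
  · refine Eventually.of_forall fun z => ?_
    refine (norm_inner_le_norm _ _).trans ?_
    have := hS.bound z
    have := hwb (z + y)
    gcongr
    exact (norm_nonneg _).trans this
  · exact ((rho_integrable hk).const_mul C).const_mul D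
  · exact Eventually.of_forall fun z => by fun_prop

lemma bq_abs_le {k C : ℝ} (hk : 0 < k) {u S : ℝ → E3} (hu : MemLp u 2 volume) (hS : Dec k C S)
    (y : ℝ) : |bq u S y| ≤ C * L2norm (rho k) * L2norm u := by
  rw [bq_shift]
  refine (abs_integral_inner_le (memLp_shift hu y) (hS.memLp hk)).trans ?_
  rw [L2norm_shift hu, mul_comm]
  exact mul_le_mul_of_nonneg_right (L2norm_le_of_bound hk hS.nonneg hS.bound) (L2norm_nonneg _)

lemma bq_sub {k C D : ℝ} (hk : 0 < k) {w W S : ℝ → E3} (hw : Continuous w) (hW : Continuous W)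
    (hwb : ∀ x, ‖w x‖ ≤ D) (hWb : ∀ x, ‖W x‖ ≤ D) (hS : Dec k C S) (y : ℝ) :
    bq w S y = bq W S y + bq (fun x => w x - W x) S y := by
  unfold bq
  simp_rw [inner_sub_left]
  rw [integral_sub (bq_integrable hk hw hwb hS y) (bq_integrable hk hW hWb hS y)]
  ring

/-! ### The orthogonality functional -/

def FS (w S : ℝ → E3) (p : ℝ × ℝ) : ℝ := bq w (fun x => rotL p.2 (S x)) p.1

def dA (w S : ℝ → E3) (p : ℝ × ℝ) : ℝ :=
  -(bq w (fun x => linP (S x)) p.1 + Real.cos p.2 * bq w (fun x => linQ (S x)) p.1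
    + Real.sin p.2 * bq w (fun x => linJ (S x)) p.1)

def dB (w S : ℝ → E3) (p : ℝ × ℝ) : ℝ :=
  Real.cos p.2 * bq w (fun x => linJ (S x)) p.1 - Real.sin p.2 * bq w (fun x => linQ (S x)) p.1

lemma FS_eq {k C D : ℝ} (hk : 0 < k) {w S : ℝ → E3} (hw : Continuous w)
    (hwb : ∀ x, ‖w x‖ ≤ D) (hS : Dec k C S) (p : ℝ × ℝ) :
    FS w S p = bq w (fun x => linP (S x)) p.1 + Real.cos p.2 * bq w (fun x => linQ (S x)) p.1
    + Real.sin p.2 * bq w (fun x => linJ (S x)) p.1 := by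
  have h1 := bq_integrable hk hw hwb (hS.comp linP norm_linP_le) p.1
  have h2 := bq_integrable hk hw hwb (hS.comp linQ norm_linQ_le) p.1
  have h3 := bq_integrable hk hw hwb (hS.comp linJ norm_linJ_le) p.1
  unfold FS bq
  simp_rw [rotL_apply, inner_add_right, inner_smul_right]
  have h4 : Integrable (fun z => inner ℝ (w z) (linP (S (z - p.1)))
      + Real.cos p.2 * inner ℝ (w z) (linQ (S (z - p.1)))) := h1.add (h2.const_mul _)
  rw [integral_add h4 (h3.const_mul _),
    integral_add h1 (h2.const_mul _), integral_const_mul, integral_const_mul]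

lemma FS_hasFDerivAt {k C D : ℝ} (hk : 0 < k) {w S S' : ℝ → E3} (hw : Continuous w)
    (hwb : ∀ x, ‖w x‖ ≤ D) (hS : Dec k C S) (hS' : Dec k C S')
    (hd : ∀ x, HasDerivAt S (S' x) x) (p : ℝ × ℝ) :
    HasFDerivAt (FS w S)
      (dA w S' p • ContinuousLinearMap.fst ℝ ℝ ℝ + dB w S p • ContinuousLinearMap.snd ℝ ℝ ℝ) p := by
  have key : ∀ (L : E3 →L[ℝ] E3) (hL : ∀ v, ‖L v‖ ≤ ‖v‖),
      HasFDerivAt (fun p : ℝ × ℝ => bq w (fun x => L (S x)) p.1)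
        ((-bq w (fun x => L (S' x)) p.1) • ContinuousLinearMap.fst ℝ ℝ ℝ) p := by
    intro L hL
    have h1 := bq_hasDerivAt hk hw hwb (hS.comp L hL) (hS'.comp L hL)
      (fun x => L.hasFDerivAt.comp_hasDerivAt x (hd x)) p.1
    exact h1.comp_hasFDerivAt p hasFDerivAt_fst
  have hc : HasFDerivAt (fun p : ℝ × ℝ => Real.cos p.2)
      ((-Real.sin p.2) • ContinuousLinearMap.snd ℝ ℝ ℝ) p :=
    (Real.hasDerivAt_cos p.2).comp_hasFDerivAt p hasFDerivAt_snd
  have hs : HasFDerivAt (fun p : ℝ × ℝ => Real.sin p.2)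
      ((Real.cos p.2) • ContinuousLinearMap.snd ℝ ℝ ℝ) p :=
    (Real.hasDerivAt_sin p.2).comp_hasFDerivAt p hasFDerivAt_snd
  have h := ((key linP norm_linP_le).add (hc.mul (key linQ norm_linQ_le))).add
    (hs.mul (key linJ norm_linJ_le))
  have e : FS w S = _ := funext (FS_eq hk hw hwb hS)
  rw [e]
  refine HasFDerivAt.congr_fderiv h ?_
  ext <;> simp [dA, dB] <;> ring

lemma core {k C : ℝ} (hk : 0 < k) {W S S' : ℝ → E3} (hW : Continuous W)
    (hWb : ∀ x, ‖W x‖ ≤ 1) (hS : Dec k C S) (hS' : Dec k C S')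
    (hd : ∀ x, HasDerivAt S (S' x) x) {α β : ℝ} (hα : dA W S' 0 = α) (hβ : dB W S 0 = β) :
    ∃ r δ : ℝ, 0 < r ∧ 0 < δ ∧ ∀ w : ℝ → E3, Continuous w → (∀ x, ‖w x‖ ≤ 1) →
      MemLp (fun x => w x - W x) 2 volume → L2norm (fun x => w x - W x) ≤ δ →
      ∀ p ∈ Metric.closedBall (0 : ℝ × ℝ) r, ∀ q ∈ Metric.closedBall (0 : ℝ × ℝ) r,
        |FS w S p - FS w S q - (α * (p.1 - q.1) + β * (p.2 - q.2))| ≤ 1 / 2 * ‖p - q‖ := by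
  have cont : ∀ (T : ℝ → E3) (_ : Dec k C T) (L : E3 →L[ℝ] E3) (hL : ∀ v, ‖L v‖ ≤ ‖v‖),
      Continuous (bq W (fun x => L (T x))) := fun T hT L hL =>
    bq_continuous hk hW hWb (hT.comp L hL)
  have cA : Continuous (dA W S') := by
    have h1 := cont S' hS' linP norm_linP_le
    have h2 := cont S' hS' linQ norm_linQ_le
    have h3 := cont S' hS' linJ norm_linJ_le
    unfold dA; fun_prop
  have cB : Continuous (dB W S) := by
    have h2 := cont S hS linQ norm_linQ_le
    have h3 := cont S hS linJ norm_linJ_le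
    unfold dB; fun_prop
  have eA := Metric.continuousAt_iff.1 (cA.continuousAt (x := (0 : ℝ × ℝ))) (1 / 8) (by norm_num)
  have eB := Metric.continuousAt_iff.1 (cB.continuousAt (x := (0 : ℝ × ℝ))) (1 / 8) (by norm_num)
  obtain ⟨r1, hr1, eA⟩ := eA
  obtain ⟨r2, hr2, eB⟩ := eB
  have hC := hS.nonneg
  set N := L2norm (rho k) with hN
  have hN0 : 0 ≤ N := L2norm_nonneg _
  refine ⟨min r1 r2 / 2, 1 / (8 * (3 * (C * N) + 1)), by positivity, by positivity, ?_⟩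
  intro w hw hwb hu hul p hp q hq
  have hsm : 3 * (C * N * L2norm (fun x => w x - W x)) ≤ 1 / 8 := by
    have h0 : 0 ≤ C * N := by positivity
    rw [le_div_iff₀ (by positivity)] at hul
    nlinarith [L2norm_nonneg (fun x => w x - W x)]
  have ub : ∀ (T : ℝ → E3) (_ : Dec k C T) (L : E3 →L[ℝ] E3) (hL : ∀ v, ‖L v‖ ≤ ‖v‖) (y : ℝ),
      |bq w (fun x => L (T x)) y - bq W (fun x => L (T x)) y|
        ≤ C * N * L2norm (fun x => w x - W x) := by
    intro T hT L hL y
    rw [bq_sub hk hw hW hwb hWb (hT.comp L hL) y, add_sub_cancel_left]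
    exact bq_abs_le hk hu (hT.comp L hL) y
  have tri : ∀ c x K : ℝ, |c| ≤ 1 → |x| ≤ K → |c * x| ≤ K := by
    intro c x K h1 h2
    rw [abs_mul]
    nlinarith [abs_nonneg c, abs_nonneg x]
  have bound : ∀ x ∈ Metric.closedBall (0 : ℝ × ℝ) (min r1 r2 / 2),
      ‖(dA w S' x • ContinuousLinearMap.fst ℝ ℝ ℝ + dB w S x • ContinuousLinearMap.snd ℝ ℝ ℝ)
        - (α • ContinuousLinearMap.fst ℝ ℝ ℝ + β • ContinuousLinearMap.snd ℝ ℝ ℝ)‖ ≤ 1 / 2 := by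
    intro x hx
    have hx' : dist x 0 ≤ min r1 r2 / 2 := hx
    have hpos : 0 < min r1 r2 := lt_min hr1 hr2
    have hxA := eA (show dist x 0 < r1 by linarith [min_le_left r1 r2])
    have hxB := eB (show dist x 0 < r2 by linarith [min_le_right r1 r2])
    rw [hα, Real.dist_eq] at hxA
    rw [hβ, Real.dist_eq] at hxB
    have hA2 : |dA w S' x - dA W S' x| ≤ 1 / 8 := by
      have h1 := ub S' hS' linP norm_linP_le x.1
      have h2 := tri (Real.cos x.2) _ _ (Real.abs_cos_le_one _) (ub S' hS' linQ norm_linQ_le x.1)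
      have h3 := tri (Real.sin x.2) _ _ (Real.abs_sin_le_one _) (ub S' hS' linJ norm_linJ_le x.1)
      unfold dA
      rw [abs_le] at *
      constructor <;> linarith [h1.1, h1.2, h2.1, h2.2, h3.1, h3.2]
    have hB2 : |dB w S x - dB W S x| ≤ 1 / 8 := by
      have h2 := tri (Real.cos x.2) _ _ (Real.abs_cos_le_one _) (ub S hS linJ norm_linJ_le x.1)
      have h3 := tri (Real.sin x.2) _ _ (Real.abs_sin_le_one _) (ub S hS linQ norm_linQ_le x.1)
      have h4 : 0 ≤ C * N * L2norm (fun x => w x - W x) :=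
        mul_nonneg (by positivity) (L2norm_nonneg _)
      unfold dB
      rw [abs_le] at *
      constructor <;> linarith [h2.1, h2.2, h3.1, h3.2]
    have hA3 : |dA w S' x - α| ≤ 1 / 4 := by
      rw [abs_lt] at hxA
      rw [abs_le] at *
      constructor <;> linarith [hxA.1, hxA.2, hA2.1, hA2.2]
    have hB3 : |dB w S x - β| ≤ 1 / 4 := by
      rw [abs_lt] at hxB
      rw [abs_le] at *
      constructor <;> linarith [hxB.1, hxB.2, hB2.1, hB2.2]
    have e : (dA w S' x • ContinuousLinearMap.fst ℝ ℝ ℝ + dB w S x • ContinuousLinearMap.snd ℝ ℝ ℝ)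
        - (α • ContinuousLinearMap.fst ℝ ℝ ℝ + β • ContinuousLinearMap.snd ℝ ℝ ℝ)
        = (dA w S' x - α) • ContinuousLinearMap.fst ℝ ℝ ℝ
          + (dB w S x - β) • ContinuousLinearMap.snd ℝ ℝ ℝ := by module
    rw [e]
    refine (norm_add_le _ _).trans ?_
    rw [norm_smul, norm_smul, Real.norm_eq_abs, Real.norm_eq_abs]
    have n1 := ContinuousLinearMap.norm_fst_le ℝ ℝ ℝ
    have n2 := ContinuousLinearMap.norm_snd_le ℝ ℝ ℝ
    have m1 := mul_le_mul hA3 n1 (norm_nonneg _) (by norm_num)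
    have m2 := mul_le_mul hB3 n2 (norm_nonneg _) (by norm_num)
    linarith
  have := Convex.norm_image_sub_le_of_norm_hasFDerivWithin_le'
    (fun x _ => (FS_hasFDerivAt hk hw hwb hS hS' hd x).hasFDerivWithinAt) bound
    (convex_closedBall _ _) hq hp
  simpa using this

lemma core2 {k C : ℝ} (hk : 0 < k) {W S S' T T' : ℝ → E3} (hW : Continuous W)
    (hWb : ∀ x, ‖W x‖ ≤ 1) (hS : Dec k C S) (hS' : Dec k C S')
    (hd : ∀ x, HasDerivAt S (S' x) x) (hT : Dec k C T) (hT' : Dec k C T')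
    (hdT : ∀ x, HasDerivAt T (T' x) x)
    (hS1 : dA W S' 0 = 1) (hS2 : dB W S 0 = 0) (hT1 : dA W T' 0 = 0) (hT2 : dB W T 0 = 1)
    (hS0 : FS W S 0 = 0) (hT0 : FS W T 0 = 0) :
    ∃ r δ K : ℝ, 0 < r ∧ r ≤ 1 ∧ 0 < δ ∧ 0 ≤ K ∧ ∀ w : ℝ → E3, Continuous w → (∀ x, ‖w x‖ ≤ 1) →
      MemLp (fun x => w x - W x) 2 volume → L2norm (fun x => w x - W x) ≤ δ →
      (∃ p ∈ Metric.closedBall (0 : ℝ × ℝ) r, FS w S p = 0 ∧ FS w T p = 0 ∧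
        ‖p‖ ≤ K * L2norm (fun x => w x - W x)) ∧
      ∀ p ∈ Metric.closedBall (0 : ℝ × ℝ) r, ∀ q ∈ Metric.closedBall (0 : ℝ × ℝ) r,
        FS w S p = 0 → FS w T p = 0 → FS w S q = 0 → FS w T q = 0 → p = q := by
  obtain ⟨r1, δ1, hr1, hδ1, h1⟩ := core hk hW hWb hS hS' hd hS1 hS2
  obtain ⟨r2, δ2, hr2, hδ2, h2⟩ := core hk hW hWb hT hT' hdT hT1 hT2
  have hC := hS.nonneg
  set N := L2norm (rho k) with hN
  have hN0 : 0 ≤ N := L2norm_nonneg _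
  set r := min 1 (min r1 r2) with hr
  have hrpos : 0 < r := by positivity
  have hrr1 : r ≤ r1 := (min_le_right _ _).trans (min_le_left _ _)
  have hrr2 : r ≤ r2 := (min_le_right _ _).trans (min_le_right _ _)
  refine ⟨r, min (min δ1 δ2) (r / (2 * (C * N) + 1)), 2 * (C * N), hrpos, min_le_left _ _,
    by positivity, by positivity, ?_⟩
  intro w hw hwb hu hul
  have hul1 := hul.trans ((min_le_left _ _).trans (min_le_left _ _))
  have hul2 := hul.trans ((min_le_left _ _).trans (min_le_right _ _))
  have hul3 := hul.trans (min_le_right _ _)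
  set U := L2norm (fun x => w x - W x) with hU
  have hU0 : 0 ≤ U := L2norm_nonneg _
  set H : ℝ × ℝ → ℝ × ℝ := fun p => (FS w S p, FS w T p) with hH
  have happ : ApproximatesLinearOn H ((ContinuousLinearEquiv.refl ℝ (ℝ × ℝ) : (ℝ × ℝ) ≃L[ℝ] (ℝ × ℝ)) : (ℝ × ℝ) →L[ℝ] (ℝ × ℝ))
      (Metric.closedBall 0 r) (1 / 2) := by
    intro p hp q hq
    have a1 := h1 w hw hwb hu hul1 p (Metric.closedBall_subset_closedBall hrr1 hp) q
      (Metric.closedBall_subset_closedBall hrr1 hq)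
    have a2 := h2 w hw hwb hu hul2 p (Metric.closedBall_subset_closedBall hrr2 hp) q
      (Metric.closedBall_subset_closedBall hrr2 hq)
    rw [Prod.norm_def]
    refine max_le ?_ ?_
    · simpa [hH] using a1
    · simpa [hH] using a2
  have hinv : ∀ p ∈ Metric.closedBall (0 : ℝ × ℝ) r, ∀ q ∈ Metric.closedBall (0 : ℝ × ℝ) r,
      ‖p - q‖ ≤ 2 * ‖H p - H q‖ := by
    intro p hp q hq
    have := happ p hp q hq
    have h3 : ‖p - q‖ ≤ ‖H p - H q‖ + ‖H p - H q - (p - q)‖ := by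
      have := norm_sub_le (H p - H q) (H p - H q - (p - q))
      simpa using this
    have h4 : ‖H p - H q - (p - q)‖ ≤ 1 / 2 * ‖p - q‖ := by simpa using this
    linarith
  constructor
  · have hH0 : ‖H 0‖ ≤ C * N * U := by
      rw [Prod.norm_def]
      have aux : ∀ (V : ℝ → E3), Dec k C V → FS W V 0 = 0 → |FS w V 0| ≤ C * N * U := by
        intro V hV hV0
        have hV' := hV.comp (rotL 0) (fun v => (norm_rotL 0 v).le)
        have := bq_sub hk hw hW hwb hWb hV' 0
        unfold FS at hV0 ⊢
        simp only [Prod.fst_zero, Prod.snd_zero] at *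
        rw [this, hV0, zero_add]
        exact bq_abs_le hk hu hV' 0
      exact max_le (aux S hS hS0) (aux T hT hT0)
    have hs := happ.surjOn_closedBall_of_nonlinearRightInverse
      ⟨fun y => y, 1, by simp, by intro y; simp⟩ (ε := 2 * ‖H 0‖) (b := 0) (by positivity)
      (Metric.closedBall_subset_closedBall (by
        rw [le_div_iff₀ (by positivity)] at hul3
        have : 0 ≤ C * N := by positivity
        nlinarith))
    have hm : (0 : ℝ × ℝ) ∈ Metric.closedBall (H 0) ((((1 : NNReal) : ℝ)⁻¹ - ((1 / 2 : NNReal) : ℝ)) * (2 * ‖H 0‖)) := by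
      rw [Metric.mem_closedBall, dist_zero_left]
      norm_num
      linarith
    obtain ⟨p, hp, hp0⟩ := hs hm
    have hpn : ‖p‖ ≤ 2 * ‖H 0‖ := by simpa using hp
    refine ⟨p, ?_, congrArg Prod.fst hp0, congrArg Prod.snd hp0, by linarith⟩
    rw [Metric.mem_closedBall, dist_zero_right]
    rw [le_div_iff₀ (by positivity)] at hul3
    have : 0 ≤ C * N := by positivity
    nlinarith
  · intro p hp q hq a b c d
    have := hinv p hp q hq
    have e : H p - H q = 0 := by simp [hH, a, b, c, d]
    rw [e, norm_zero, mul_zero] at this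
    exact sub_eq_zero.1 (norm_le_zero_iff.1 this)

/-! ### The profile -/

def sg (k x : ℝ) : ℝ := (Real.cosh (k * x))⁻¹

def th (k x : ℝ) : ℝ := Real.sinh (k * x) * (Real.cosh (k * x))⁻¹

lemma sg_pos (k x : ℝ) : 0 < sg k x := inv_pos.2 (Real.cosh_pos _)

lemma sg_le_one (k x : ℝ) : sg k x ≤ 1 := inv_le_one_of_one_le₀ (Real.one_le_cosh _)

lemma th_sq (k x : ℝ) : th k x ^ 2 = 1 - sg k x ^ 2 := by
  have h := (Real.cosh_pos (k * x)).ne'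
  have := Real.cosh_sq (k * x)
  unfold th sg
  field_simp
  linarith

lemma sg_le_rho {k : ℝ} (hk : 0 < k) (x : ℝ) : sg k x ≤ 2 * rho k x := by
  unfold sg rho
  rw [Real.exp_neg, ← div_eq_mul_inv, inv_eq_one_div,
    div_le_div_iff₀ (Real.cosh_pos _) (Real.exp_pos _), ← Real.cosh_abs, abs_mul, abs_of_pos hk,
    Real.cosh_eq]
  linarith [Real.exp_pos (-(k * |x|))]

lemma sg_hasDerivAt (k x : ℝ) : HasDerivAt (sg k) (-(k * sg k x * th k x)) x := by
  have h0 := (Real.cosh_pos (k * x)).ne'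
  have h1 : HasDerivAt (fun x => k * x) k x := by simpa using (hasDerivAt_id x).const_mul k
  refine (h1.cosh.inv h0).congr_deriv ?_
  unfold sg th
  field_simp

lemma th_hasDerivAt (k x : ℝ) : HasDerivAt (th k) (k * sg k x ^ 2) x := by
  have h0 := (Real.cosh_pos (k * x)).ne'
  have h1 : HasDerivAt (fun x => k * x) k x := by simpa using (hasDerivAt_id x).const_mul k
  refine (h1.sinh.mul (h1.cosh.inv h0)).congr_deriv ?_
  have := Real.cosh_sq (k * x)
  unfold sg
  simp only [Pi.inv_apply]
  field_simp
  rw [this]; ring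

lemma sg_cont (k : ℝ) : Continuous (sg k) :=
  continuous_iff_continuousAt.2 fun x => (sg_hasDerivAt k x).continuousAt

lemma th_cont (k : ℝ) : Continuous (th k) :=
  continuous_iff_continuousAt.2 fun x => (th_hasDerivAt k x).continuousAt

lemma cos_theta (γ x : ℝ) : Real.cos (thetaStar γ x) = th (Real.sqrt (1 - γ ^ 2)) x := by
  unfold thetaStar th
  generalize Real.sqrt (1 - γ ^ 2) = k
  rw [Real.cos_two_mul, Real.cos_sq_arctan, Real.sinh_eq, Real.cosh_eq, neg_mul, Real.exp_neg]
  have := Real.exp_pos (k * x)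
  field_simp
  ring

lemma sin_theta (γ x : ℝ) : Real.sin (thetaStar γ x) = sg (Real.sqrt (1 - γ ^ 2)) x := by
  unfold thetaStar sg
  generalize Real.sqrt (1 - γ ^ 2) = k
  have h : ∀ t : ℝ, Real.sin (2 * Real.arctan t) = 2 * t * (1 / (1 + t ^ 2)) := by
    intro t
    rw [← Real.cos_sq_arctan, Real.sin_two_mul]
    have := Real.tan_mul_cos (Real.cos_arctan_pos t).ne'
    rw [Real.tan_arctan] at this
    rw [← this]; ring
  rw [h, Real.cosh_eq, neg_mul, Real.exp_neg]
  have := Real.exp_pos (k * x)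
  field_simp

def Wf (k γ s x : ℝ) : E3 :=
  !₂[th k x, s * (sg k x * Real.cos (γ * x)), -(s * (sg k x * Real.sin (γ * x)))]

def Af (k γ s x : ℝ) : E3 :=
  !₂[sg k x * (k * sg k x), sg k x * -(s * k * th k x * Real.cos (γ * x)),
    sg k x * (s * k * th k x * Real.sin (γ * x))]

def Af' (k γ s x : ℝ) : E3 :=
  !₂[sg k x * -(2 * k ^ 2 * sg k x * th k x),
    sg k x * (s * k * (k * th k x ^ 2 * Real.cos (γ * x) - k * sg k x ^ 2 * Real.cos (γ * x)
      + th k x * γ * Real.sin (γ * x))),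
    sg k x * (s * k * (-(k * th k x ^ 2 * Real.sin (γ * x)) + k * sg k x ^ 2 * Real.sin (γ * x)
      + th k x * γ * Real.cos (γ * x)))]

def Bf (k γ s x : ℝ) : E3 := linJ (Wf k γ s x)

def Bf' (k γ s x : ℝ) : E3 := linJ (Af k γ s x - γ • Bf k γ s x)

lemma wStar_eq (γ s : ℝ) : wStar γ s = Wf (Real.sqrt (1 - γ ^ 2)) γ s := by
  funext x
  unfold wStar Wf
  rw [cos_theta, sin_theta]
  simp [phiStar]

lemma hcos (γ x : ℝ) : HasDerivAt (fun x => Real.cos (γ * x)) (-(γ * Real.sin (γ * x))) x := by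
  have h1 : HasDerivAt (fun x => γ * x) γ x := by simpa using (hasDerivAt_id x).const_mul γ
  refine h1.cos.congr_deriv (by ring)

lemma hsin (γ x : ℝ) : HasDerivAt (fun x => Real.sin (γ * x)) (γ * Real.cos (γ * x)) x := by
  have h1 : HasDerivAt (fun x => γ * x) γ x := by simpa using (hasDerivAt_id x).const_mul γ
  refine h1.sin.congr_deriv (by ring)

lemma Wf_hasDerivAt (k γ s x : ℝ) :
    HasDerivAt (Wf k γ s) (Af k γ s x - γ • Bf k γ s x) x := by
  have hσ := sg_hasDerivAt k x
  have hτ := th_hasDerivAt k x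
  have hc := hcos γ x
  have hd := hsin γ x
  apply hasDerivAt_E3
  intro i
  fin_cases i
  · refine hτ.congr_deriv ?_
    simp [Af, Bf, linJ_apply, Wf]; ring
  · refine ((hσ.mul hc).const_mul s).congr_deriv ?_
    simp [Af, Bf, linJ_apply, Wf]; ring
  · refine ((hσ.mul hd).const_mul s).neg.congr_deriv ?_
    simp [Af, Bf, linJ_apply, Wf]; ring

lemma Af_hasDerivAt (k γ s x : ℝ) : HasDerivAt (Af k γ s) (Af' k γ s x) x := by
  have hσ := sg_hasDerivAt k x
  have hτ := th_hasDerivAt k x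
  have hc := hcos γ x
  have hd := hsin γ x
  apply hasDerivAt_E3
  intro i
  fin_cases i
  · refine (hσ.mul (hσ.const_mul k)).congr_deriv ?_
    simp [Af']; ring
  · refine (hσ.mul ((hτ.const_mul (s * k)).mul hc).neg).congr_deriv ?_
    simp [Af']; ring
  · refine (hσ.mul ((hτ.const_mul (s * k)).mul hd)).congr_deriv ?_
    simp [Af']; ring

lemma Bf_hasDerivAt (k γ s x : ℝ) : HasDerivAt (Bf k γ s) (Bf' k γ s x) x :=
  linJ.hasFDerivAt.comp_hasDerivAt x (Wf_hasDerivAt k γ s x)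

lemma norm_Wf {s : ℝ} (hs : s ^ 2 = 1) (k γ x : ℝ) : ‖Wf k γ s x‖ = 1 := by
  have : ‖Wf k γ s x‖ ^ 2 = 1 := by
    rw [norm_sq_E3]
    simp [Wf]
    rw [th_sq, mul_pow, mul_pow, mul_pow, mul_pow, hs, Real.sin_sq]; ring
  exact (sq_eq_sq₀ (norm_nonneg _) zero_le_one).1 (by simpa using this)

lemma inner_W_A {s : ℝ} (hs : s ^ 2 = 1) (k γ x : ℝ) :
    inner ℝ (Wf k γ s x) (Af k γ s x) = 0 := by
  rw [← dot3_eq_inner]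
  simp [dot3, Wf, Af]
  linear_combination (-(sg k x ^ 2 * k * th k x)) * (Real.sin_sq_add_cos_sq (γ * x))
    - (sg k x ^ 2 * k * th k x) * (Real.sin (γ * x) ^ 2 + Real.cos (γ * x) ^ 2) * hs

lemma inner_W_B (k γ s x : ℝ) : inner ℝ (Wf k γ s x) (Bf k γ s x) = 0 := by
  rw [← dot3_eq_inner]
  simp [dot3, Wf, Bf, linJ_apply]
  ring

lemma inner_W_JA (k γ s x : ℝ) : inner ℝ (Wf k γ s x) (linJ (Af k γ s x)) = 0 := by
  rw [← dot3_eq_inner]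
  simp [dot3, Wf, Af, linJ_apply]
  ring

lemma inner_W_JB {s : ℝ} (hs : s ^ 2 = 1) (k γ x : ℝ) :
    inner ℝ (Wf k γ s x) (linJ (Bf k γ s x)) = -sg k x ^ 2 := by
  rw [← dot3_eq_inner]
  simp [dot3, Wf, Bf, linJ_apply]
  linear_combination (-(sg k x ^ 2)) * (Real.sin_sq_add_cos_sq (γ * x))
    - (sg k x ^ 2) * (Real.sin (γ * x) ^ 2 + Real.cos (γ * x) ^ 2) * hs

lemma inner_W_A' {s : ℝ} (hs : s ^ 2 = 1) (k γ x : ℝ) :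
    inner ℝ (Wf k γ s x) (Af' k γ s x) = -(k ^ 2 * sg k x ^ 2) := by
  rw [← dot3_eq_inner]
  simp [dot3, Wf, Af']
  have h1 := Real.sin_sq_add_cos_sq (γ * x)
  have h2 := th_sq k x
  linear_combination (sg k x ^ 2 * k ^ 2 * (th k x ^ 2 - sg k x ^ 2)) * h1
    + (sg k x ^ 2 * k ^ 2 * (th k x ^ 2 - sg k x ^ 2))
      * (Real.sin (γ * x) ^ 2 + Real.cos (γ * x) ^ 2) * hs
    - sg k x ^ 2 * k ^ 2 * h2

lemma inner_W_B' {s : ℝ} (hs : s ^ 2 = 1) (k γ x : ℝ) :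
    inner ℝ (Wf k γ s x) (Bf' k γ s x) = γ * sg k x ^ 2 := by
  unfold Bf'
  rw [map_sub, map_smul, inner_sub_right, inner_smul_right, inner_W_JA, inner_W_JB hs]
  ring

lemma abs_sg_mul_le {k c K : ℝ} (hk : 0 < k) (x : ℝ) (h : |c| ≤ K) :
    |sg k x * c| ≤ 2 * K * rho k x := by
  rw [abs_mul, abs_of_pos (sg_pos k x)]
  have := sg_le_rho hk x
  have := sg_pos k x
  have := abs_nonneg c
  nlinarith

lemma abs_mul_le_one {a b : ℝ} (ha : |a| ≤ 1) (hb : |b| ≤ 1) : |a * b| ≤ 1 := by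
  rw [abs_mul]; exact mul_le_one₀ ha (abs_nonneg _) hb

lemma abs_th_le (k x : ℝ) : |th k x| ≤ 1 := by
  rw [← sq_le_one_iff_abs_le_one, th_sq]; nlinarith [sq_nonneg (sg k x)]

lemma abs_sg_le (k x : ℝ) : |sg k x| ≤ 1 := by
  rw [abs_of_pos (sg_pos k x)]; exact sg_le_one k x

lemma abs_le_one_s {s : ℝ} (hs : s ^ 2 = 1) : |s| ≤ 1 := by
  rw [← sq_le_one_iff_abs_le_one, hs]

lemma Wf_cont (k γ s : ℝ) : Continuous (Wf k γ s) :=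
  continuous_iff_continuousAt.2 fun x => (Wf_hasDerivAt k γ s x).continuousAt

lemma Q_Wf_bound {k γ s : ℝ} (hk : 0 < k) (hs : s ^ 2 = 1) (x : ℝ) :
    ‖linQ (Wf k γ s x)‖ ≤ 4 * rho k x := by
  refine (norm_le_E3 _).trans ?_
  have hs1 := abs_le_one_s hs
  have h1 := abs_sg_mul_le hk x (abs_mul_le_one hs1 (Real.abs_cos_le_one (γ * x)))
  have h2 := abs_sg_mul_le hk x (abs_mul_le_one hs1 (Real.abs_sin_le_one (γ * x)))
  simp only [linQ_apply, Wf]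
  simp
  rw [abs_mul, abs_mul] at h1 h2
  linarith

lemma Af_dec {k γ s : ℝ} (hk : 0 < k) (hk1 : k ≤ 1) (hs : s ^ 2 = 1) :
    Dec k 6 (Af k γ s) := by
  refine ⟨continuous_iff_continuousAt.2 fun x => (Af_hasDerivAt k γ s x).continuousAt, fun x => ?_⟩
  refine (norm_le_E3 _).trans ?_
  have hs1 := abs_le_one_s hs
  have hk2 : |k| ≤ 1 := by rw [abs_of_pos hk]; exact hk1
  have ht := abs_mul_le_one (abs_mul_le_one hs1 hk2) (abs_th_le k x)
  have h0 := abs_sg_mul_le hk x (abs_mul_le_one hk2 (abs_sg_le k x))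
  have h1 := abs_sg_mul_le hk x (abs_mul_le_one ht (Real.abs_cos_le_one (γ * x)))
  have h2 := abs_sg_mul_le hk x (abs_mul_le_one ht (Real.abs_sin_le_one (γ * x)))
  simp only [Af]
  simp only [Matrix.cons_val, mul_neg, abs_neg]
  linarith

lemma abs_add3_le {a b c : ℝ} (ha : |a| ≤ 1) (hb : |b| ≤ 1) (hc : |c| ≤ 1) : |a + b + c| ≤ 3 := by
  rw [abs_le] at *
  constructor <;> linarith [ha.1, ha.2, hb.1, hb.2, hc.1, hc.2]

lemma Af'_dec {k γ s : ℝ} (hk : 0 < k) (hk1 : k ≤ 1) (hγ : |γ| ≤ 1) (hs : s ^ 2 = 1) :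
    Dec k 16 (Af' k γ s) := by
  have hsc := sg_cont k
  have htc := th_cont k
  refine ⟨by unfold Af'; fun_prop, fun x => ?_⟩
  refine (norm_le_E3 _).trans ?_
  have hs1 := abs_le_one_s hs
  have hk2 : |k| ≤ 1 := by rw [abs_of_pos hk]; exact hk1
  have ht := abs_th_le k x
  have hg := abs_sg_le k x
  have hc := Real.abs_cos_le_one (γ * x)
  have hd := Real.abs_sin_le_one (γ * x)
  have h0 : |-(2 * k ^ 2 * sg k x * th k x)| ≤ 2 := by
    rw [abs_neg, show 2 * k ^ 2 * sg k x * th k x = 2 * (k * k * sg k x * th k x) by ring, abs_mul]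
    have := abs_mul_le_one (abs_mul_le_one (abs_mul_le_one hk2 hk2) hg) ht
    rw [abs_of_pos (two_pos)]; linarith
  have sk := abs_mul_le_one hs1 hk2
  have h3 : ∀ a : ℝ, |a| ≤ 3 → |s * k * a| ≤ 3 := by
    intro a ha
    rw [abs_mul]
    nlinarith [abs_nonneg a, abs_nonneg (s * k)]
  have t2 : |th k x ^ 2| ≤ 1 := by rw [sq]; exact abs_mul_le_one ht ht
  have g2 : |sg k x ^ 2| ≤ 1 := by rw [sq]; exact abs_mul_le_one hg hg
  have h1 : |s * k * (k * th k x ^ 2 * Real.cos (γ * x) - k * sg k x ^ 2 * Real.cos (γ * x)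
      + th k x * γ * Real.sin (γ * x))| ≤ 3 := by
    apply h3
    rw [sub_eq_add_neg]
    apply abs_add3_le
    · exact abs_mul_le_one (abs_mul_le_one hk2 t2) hc
    · rw [abs_neg]; exact abs_mul_le_one (abs_mul_le_one hk2 g2) hc
    · exact abs_mul_le_one (abs_mul_le_one ht hγ) hd
  have h2 : |s * k * (-(k * th k x ^ 2 * Real.sin (γ * x)) + k * sg k x ^ 2 * Real.sin (γ * x)
      + th k x * γ * Real.cos (γ * x))| ≤ 3 := by
    apply h3
    apply abs_add3_le
    · rw [abs_neg]; exact abs_mul_le_one (abs_mul_le_one hk2 t2) hd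
    · exact abs_mul_le_one (abs_mul_le_one hk2 g2) hd
    · exact abs_mul_le_one (abs_mul_le_one ht hγ) hc
  have b0 := abs_sg_mul_le hk x h0
  have b1 := abs_sg_mul_le hk x h1
  have b2 := abs_sg_mul_le hk x h2
  simp only [Af']
  simp only [Matrix.cons_val]
  linarith

lemma Bf_dec {k γ s : ℝ} (hk : 0 < k) (hs : s ^ 2 = 1) : Dec k 4 (Bf k γ s) :=
  ⟨linJ.continuous.comp (Wf_cont k γ s), fun x => by
    unfold Bf; rw [norm_linJ_eq]; exact Q_Wf_bound hk hs x⟩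

lemma Wf'_dec {k γ s : ℝ} (hk : 0 < k) (hk1 : k ≤ 1) (hγ : |γ| ≤ 1) (hs : s ^ 2 = 1) :
    Dec k 10 (fun x => Af k γ s x - γ • Bf k γ s x) := by
  have := ((Af_dec (γ := γ) hk hk1 hs).add ((Bf_dec (γ := γ) hk hs).smul (-γ))).mono
    (show _ ≤ (10 : ℝ) by rw [abs_neg]; linarith)
  simpa [sub_eq_add_neg] using this

lemma Bf'_dec {k γ s : ℝ} (hk : 0 < k) (hk1 : k ≤ 1) (hγ : |γ| ≤ 1) (hs : s ^ 2 = 1) :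
    Dec k 10 (Bf' k γ s) :=
  (Wf'_dec hk hk1 hγ hs).comp linJ norm_linJ_le

lemma Wf''_dec {k γ s : ℝ} (hk : 0 < k) (hk1 : k ≤ 1) (hγ : |γ| ≤ 1) (hs : s ^ 2 = 1) :
    Dec k 26 (fun x => Af' k γ s x - γ • Bf' k γ s x) := by
  have := ((Af'_dec (γ := γ) hk hk1 hγ hs).add ((Bf'_dec (γ := γ) hk hk1 hγ hs).smul (-γ))).mono
    (show _ ≤ (26 : ℝ) by rw [abs_neg]; linarith)
  simpa [sub_eq_add_neg] using this

lemma Wf'_hasDerivAt (k γ s x : ℝ) :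
    HasDerivAt (fun x => Af k γ s x - γ • Bf k γ s x) (Af' k γ s x - γ • Bf' k γ s x) x :=
  (Af_hasDerivAt k γ s x).sub ((Bf_hasDerivAt k γ s x).const_smul γ)

lemma sg_sq_integrable {k : ℝ} (hk : 0 < k) : Integrable (fun x => sg k x ^ 2) := by
  refine ((rho_integrable hk).const_mul 2).mono' ((sg_cont k).pow 2).aestronglyMeasurable
    (Eventually.of_forall fun x => ?_)
  have h1 := sg_le_rho hk x
  have h2 := sg_pos k x
  have h3 := sg_le_one k x
  rw [Real.norm_eq_abs, abs_of_nonneg (sq_nonneg _)]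
  nlinarith

lemma sg_sq_pos {k : ℝ} (hk : 0 < k) : 0 < ∫ x, sg k x ^ 2 :=
  integral_pos_of_integrable_nonneg_nonzero (x := 0) ((sg_cont k).pow 2) (sg_sq_integrable hk)
    (fun _ => sq_nonneg _) (pow_pos (sg_pos k 0) 2).ne'

/-! ### Shifts and rotations of the profile -/

lemma shift_bound {k C : ℝ} (hk : 0 < k) (hC : 0 ≤ C) {V V' : ℝ → E3}
    (hd : ∀ x, HasDerivAt V (V' x) x) (hV' : ∀ x, ‖V' x‖ ≤ C * rho k x)
    (hQ : ∀ x, ‖linQ (V x)‖ ≤ C * rho k x) {y φ m : ℝ} (hy : |y| ≤ m) (hφ : |φ| ≤ m)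
    (hm : m ≤ 1) (x : ℝ) :
    ‖rotL φ (V (x + y)) - V x‖ ≤ 3 * C * Real.exp k * m * rho k x := by
  have hm0 : 0 ≤ m := (abs_nonneg y).trans hy
  have sh : ∀ t : ℝ, |t - x| ≤ |y| → rho k t ≤ Real.exp k * rho k x := by
    intro t ht
    have h1 := rho_shift hk x (x - t)
    rw [_root_.sub_sub_cancel] at h1
    refine h1.trans (mul_le_mul_of_nonneg_right (Real.exp_le_exp.2 ?_) (rho_pos k x).le)
    rw [abs_sub_comm] at ht
    nlinarith [ht.trans (hy.trans hm)]
  have h1 : ‖V (x + y) - V x‖ ≤ C * (Real.exp k * rho k x) * ‖x + y - x‖ := by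
    refine Convex.norm_image_sub_le_of_norm_hasDerivWithin_le (s := Metric.closedBall x |y|)
      (f' := V') (fun t _ => (hd t).hasDerivWithinAt) (fun t ht => ?_) (convex_closedBall _ _)
      (Metric.mem_closedBall_self (abs_nonneg y)) (by simp)
    exact (hV' t).trans (mul_le_mul_of_nonneg_left (sh t ht) hC)
  have h2 := rot_sub_le φ (V (x + y))
  have h3 := (hQ (x + y)).trans (mul_le_mul_of_nonneg_left (sh (x + y) (by simp)) hC)
  have e : rotL φ (V (x + y)) - V x
      = (rotL φ (V (x + y)) - V (x + y)) + (V (x + y) - V x) := by abel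
  rw [e]
  have hR : 0 ≤ C * (Real.exp k * rho k x) :=
    mul_nonneg hC (mul_nonneg (Real.exp_pos k).le (rho_pos k x).le)
  rw [add_sub_cancel_left, Real.norm_eq_abs] at h1
  refine (norm_add_le _ _).trans ?_
  have h4 : 2 * |φ| * ‖linQ (V (x + y))‖ ≤ 2 * m * (C * (Real.exp k * rho k x)) := by
    gcongr
  have h5 := mul_le_mul_of_nonneg_left hy hR
  nlinarith

lemma L2_part {k C : ℝ} (hk : 0 < k) (hC : 0 ≤ C) {V V' u : ℝ → E3}
    (hd : ∀ x, HasDerivAt V (V' x) x) (hV' : ∀ x, ‖V' x‖ ≤ C * rho k x)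
    (hQ : ∀ x, ‖linQ (V x)‖ ≤ C * rho k x) {y φ m : ℝ} (hy : |y| ≤ m) (hφ : |φ| ≤ m)
    (hm : m ≤ 1) (hu : MemLp u 2 volume) :
    L2norm (fun x => rotL φ (u (x + y)) + (rotL φ (V (x + y)) - V x))
      ≤ L2norm u + 3 * C * Real.exp k * m * L2norm (rho k) := by
  have hb := shift_bound hk hC hd hV' hQ hy hφ hm
  have hm0 : 0 ≤ m := (abs_nonneg y).trans hy
  have hVc : Continuous V := continuous_iff_continuousAt.2 fun x => (hd x).continuousAt
  have hK : 0 ≤ 3 * C * Real.exp k * m := by positivity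
  have hmem1 : MemLp (fun x => rotL φ (u (x + y))) 2 volume :=
    (rotL φ).comp_memLp' (memLp_shift hu y)
  have hmem2 : MemLp (fun x => rotL φ (V (x + y)) - V x) 2 volume := by
    refine ((rho_memLp hk).const_mul (3 * C * Real.exp k * m)).mono'
      (Continuous.aestronglyMeasurable (by fun_prop)) (Eventually.of_forall hb)
  have h1 : L2norm (fun x => rotL φ (u (x + y))) = L2norm u := by
    rw [← L2norm_shift hu y]
    unfold L2norm
    congr 1
    exact eLpNorm_congr_norm_ae (Eventually.of_forall fun x => norm_rotL φ _)
  refine (L2norm_add_le hmem1 hmem2).trans ?_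
  rw [h1]
  exact add_le_add_right (L2norm_le_of_bound hk hK hb) _

lemma H1_part {k C : ℝ} (hk : 0 < k) (hC : 0 ≤ C) {W V V' w : ℝ → E3}
    (hd : ∀ x, HasDerivAt W (V x) x) (hV : ∀ x, ‖V x‖ ≤ C * rho k x)
    (hQ : ∀ x, ‖linQ (W x)‖ ≤ C * rho k x)
    (hdV : ∀ x, HasDerivAt V (V' x) x) (hV' : ∀ x, ‖V' x‖ ≤ C * rho k x)
    {y φ m : ℝ} (hy : |y| ≤ m) (hφ : |φ| ≤ m)
    (hm : m ≤ 1) (hw : Differentiable ℝ w) (hu : MemLp (fun x => w x - W x) 2 volume)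
    (hu' : MemLp (deriv (fun x => w x - W x)) 2 volume) :
    H1norm (fun x => rot (-φ) (w (x + y)) - W x)
      ≤ H1norm (fun x => w x - W x) + 6 * C * Real.exp k * L2norm (rho k) * m := by
  have hφ' : |-φ| ≤ m := by rwa [abs_neg]
  have hdu : ∀ x, HasDerivAt (fun x => w x - W x) (deriv w x - V x) x := fun x =>
    (hw x).hasDerivAt.sub (hd x)
  have e1 : (fun x => rot (-φ) (w (x + y)) - W x)
      = fun x => rotL (-φ) ((fun x => w x - W x) (x + y)) + (rotL (-φ) (W (x + y)) - W x) := by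
    funext x; rw [rot_eq]; simp only [map_sub]; abel
  have e2 : deriv (fun x => rot (-φ) (w (x + y)) - W x)
      = fun x => rotL (-φ) (deriv (fun x => w x - W x) (x + y))
          + (rotL (-φ) (V (x + y)) - V x) := by
    funext x
    rw [(hdu (x + y)).deriv]
    have h1 : HasDerivAt (fun x => w (x + y)) (deriv w (x + y)) x :=
      (hw (x + y)).hasDerivAt.comp_add_const x y
    have h2 : HasDerivAt (fun x => rotL (-φ) (w (x + y)) - W x)
        (rotL (-φ) (deriv w (x + y)) - V x) x :=
      ((rotL (-φ)).hasFDerivAt.comp_hasDerivAt x h1).sub (hd x)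
    simp only [rot_eq]
    rw [h2.deriv, map_sub]; abel
  have a1 := L2_part hk hC hd hV hQ hy hφ' hm hu
  have a2 := L2_part hk hC hdV hV' (fun x => (norm_linQ_le _).trans (hV x)) hy hφ' hm hu'
  unfold H1norm
  rw [e2, e1]
  linarith

/-! ### Reformulating the orthogonality conditions -/

lemma FS_comb {k C D : ℝ} (hk : 0 < k) {w S T : ℝ → E3} (hw : Continuous w)
    (hwb : ∀ x, ‖w x‖ ≤ 1) (hS : Dec k C S) (hT : Dec k D T) (a b : ℝ) (p : ℝ × ℝ) :
    FS w (fun x => a • S x + b • T x) p = a * FS w S p + b * FS w T p := by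
  have h1 := bq_integrable hk hw hwb (hS.comp (rotL p.2) (fun v => (norm_rotL _ v).le)) p.1
  have h2 := bq_integrable hk hw hwb (hT.comp (rotL p.2) (fun v => (norm_rotL _ v).le)) p.1
  unfold FS bq
  simp only [map_add, map_smul, inner_add_right, inner_smul_right]
  rw [integral_add (h1.const_mul a) (h2.const_mul b), integral_const_mul, integral_const_mul]

lemma orth_eq_FS (w W S : ℝ → E3) (hWS : ∀ x, inner ℝ (W x) (S x) = 0) (y φ : ℝ) :
    (∫ x, dot3 (rot (-φ) (w (x + y)) - W x) (S x)) = FS w S (y, φ) := by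
  unfold FS
  rw [bq_shift]
  congr 1
  funext x
  rw [dot3_eq_inner, inner_sub_left, hWS, sub_zero, inner_rot_neg, rot_eq]

lemma FS_zero (W S : ℝ → E3) : FS W S 0 = ∫ x, inner ℝ (W x) (S x) := by
  unfold FS bq
  simp [rotL_apply, linPQ]

lemma dB_zero (W S : ℝ → E3) : dB W S 0 = ∫ x, inner ℝ (W x) (linJ (S x)) := by
  unfold dB bq
  simp

lemma dA_eq {k C : ℝ} (hk : 0 < k) {W S : ℝ → E3} (hW : Continuous W)
    (hWb : ∀ x, ‖W x‖ ≤ 1) (hS : Dec k C S) :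
    dA W S 0 = -∫ x, inner ℝ (W x) (S x) := by
  rw [← FS_zero, FS_eq hk hW hWb hS]; rfl

lemma modulation_aux {k γ s : ℝ} (hk : 0 < k) (hk1 : k ≤ 1) (hγ : |γ| ≤ 1) (hs : s ^ 2 = 1) :
    ∃ r δ K : ℝ, 0 < r ∧ r ≤ 1 ∧ 0 < δ ∧ 0 ≤ K ∧ ∀ w : ℝ → E3, Continuous w → (∀ x, ‖w x‖ ≤ 1) →
      MemLp (fun x => w x - Wf k γ s x) 2 volume → L2norm (fun x => w x - Wf k γ s x) ≤ δ →
      (∃ p ∈ Metric.closedBall (0 : ℝ × ℝ) r, FS w (Af k γ s) p = 0 ∧ FS w (Bf k γ s) p = 0 ∧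
        ‖p‖ ≤ K * L2norm (fun x => w x - Wf k γ s x)) ∧
      ∀ p ∈ Metric.closedBall (0 : ℝ × ℝ) r, ∀ q ∈ Metric.closedBall (0 : ℝ × ℝ) r,
        FS w (Af k γ s) p = 0 → FS w (Bf k γ s) p = 0 →
        FS w (Af k γ s) q = 0 → FS w (Bf k γ s) q = 0 → p = q := by
  set I := ∫ x, sg k x ^ 2 with hI
  have hI0 : 0 < I := sg_sq_pos hk
  have hA := Af_dec (γ := γ) hk hk1 hs
  have hA' := Af'_dec hk hk1 hγ hs
  have hB := Bf_dec (γ := γ) hk hs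
  have hB' := Bf'_dec hk hk1 hγ hs
  have hWb : ∀ x, ‖Wf k γ s x‖ ≤ 1 := fun x => (norm_Wf hs k γ x).le
  have hWc := Wf_cont k γ s
  set a := 1 / (k ^ 2 * I) with ha
  set b := -(1 / I) with hb
  set c := -(γ / (k ^ 2 * I)) with hc
  have dec : ∀ (a b : ℝ) (S T : ℝ → E3), Dec k 16 S → Dec k 16 T →
      Dec k (|a| * 16 + |b| * 16) (fun x => a • S x + b • T x) := fun a b S T hS hT =>
    (hS.smul a).add (hT.smul b)
  set Cm := max (|a| * 16 + |(0:ℝ)| * 16) (|c| * 16 + |b| * 16) with hCm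
  have der : ∀ (a b x : ℝ), HasDerivAt (fun x => a • Af k γ s x + b • Bf k γ s x)
      (a • Af' k γ s x + b • Bf' k γ s x) x := fun a b x =>
    ((Af_hasDerivAt k γ s x).const_smul a).add ((Bf_hasDerivAt k γ s x).const_smul b)
  have hA6 : Dec k 16 (Af k γ s) := hA.mono (by norm_num)
  have hB6 : Dec k 16 (Bf k γ s) := hB.mono (by norm_num)
  have hB6' : Dec k 16 (Bf' k γ s) := hB'.mono (by norm_num)
  have d1 := (dec a 0 _ _ hA6 hB6).mono (le_max_left _ (|c| * 16 + |b| * 16))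
  have d1' := (dec a 0 _ _ hA' hB6').mono (le_max_left _ (|c| * 16 + |b| * 16))
  have d2 := (dec c b _ _ hA6 hB6).mono (le_max_right (|a| * 16 + |(0:ℝ)| * 16) _)
  have d2' := (dec c b _ _ hA' hB6').mono (le_max_right (|a| * 16 + |(0:ℝ)| * 16) _)
  have z : ∀ a b : ℝ, FS (Wf k γ s) (fun x => a • Af k γ s x + b • Bf k γ s x) 0 = 0 := by
    intro a b
    rw [FS_zero]
    simp [inner_add_right, inner_smul_right, inner_W_A hs, inner_W_B]
  have vA : ∀ a b : ℝ, dA (Wf k γ s) (fun x => a • Af' k γ s x + b • Bf' k γ s x) 0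
      = (a * k ^ 2 - b * γ) * I := by
    intro a b
    rw [dA_eq hk hWc hWb (dec a b _ _ hA' hB6'), ← integral_neg, hI, ← integral_const_mul]
    congr 1
    funext x
    rw [inner_add_right, inner_smul_right, inner_smul_right, inner_W_A' hs, inner_W_B' hs]
    ring
  have vB : ∀ a b : ℝ, dB (Wf k γ s) (fun x => a • Af k γ s x + b • Bf k γ s x) 0
      = -b * I := by
    intro a b
    rw [dB_zero, hI, ← integral_const_mul]
    congr 1
    funext x
    rw [map_add, map_smul, map_smul, inner_add_right, inner_smul_right, inner_smul_right,
      inner_W_JA, inner_W_JB hs]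
    ring
  obtain ⟨r, δ, K, hr, hr1, hδ, hK, H⟩ := core2 hk hWc hWb d1 d1' (der a 0) d2 d2' (der c b)
    (by rw [vA, ha]; field_simp; ring) (by rw [vB]; ring) (by rw [vA, hc, hb]; field_simp; ring)
    (by rw [vB, hb]; field_simp) (z _ _) (z _ _)
  refine ⟨r, δ, K, hr, hr1, hδ, hK, ?_⟩
  intro w hw hwb hu hul
  have H := H w hw hwb hu hul
  have e : ∀ a b p, FS w (fun x => a • Af k γ s x + b • Bf k γ s x) p = _ := fun a b p =>
    FS_comb hk hw hwb hA hB a b p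
  simp only [e] at H
  have ha0 : a ≠ 0 := by rw [ha]; positivity
  have hb0 : b ≠ 0 := by rw [hb]; exact neg_ne_zero.2 (by positivity)
  obtain ⟨⟨p, hp, h1, h2, h3⟩, H2⟩ := H
  refine ⟨⟨p, hp, ?_, ?_, h3⟩, ?_⟩
  · simpa [ha0] using h1
  · have hA0 : FS w (Af k γ s) p = 0 := by simpa [ha0] using h1
    simpa [hA0, hb0] using h2
  · intro p hp q hq h1 h2 h3 h4
    exact H2 p hp q hq (by simp [h1]) (by simp [h1, h2]) (by simp [h3]) (by simp [h3, h4])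

/-- modulation lemma — for maps H¹-close to the static wall w_*, there
    exists a unique gauge (y,φ) giving the pointwise constraint, the two orthogonality
    conditions, and the linear bound. Here ε(x) = R_{−φ} w(x+y) − w_*(x). -/
theorem modulation (γ : ℝ) (hγ : -1 < γ ∧ γ < 1) (s : ℝ) (hs : s = 1 ∨ s = -1) :
    ∃ δ₁ C₁ : ℝ, 0 < δ₁ ∧ 1 ≤ C₁ ∧
      ∀ w : ℝ → E3, ContDiff ℝ 1 w → (∀ x, ‖w x‖ = 1) →
      MemLp (fun x => w x - wStar γ s x) 2 volume →
      MemLp (deriv (fun x => w x - wStar γ s x)) 2 volume →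
      H1norm (fun x => w x - wStar γ s x) ≤ δ₁ →
      ∃ y φ : ℝ,
        (∀ x : ℝ,
          2 * dot3 (rot (-φ) (w (x + y)) - wStar γ s x) (wStar γ s x)
            + ‖rot (-φ) (w (x + y)) - wStar γ s x‖ ^ 2 = 0) ∧
        (∫ x : ℝ, dot3 (rot (-φ) (w (x + y)) - wStar γ s x) (deriv (wStar γ s) x)) = 0 ∧
        (∫ x : ℝ, dot3 (rot (-φ) (w (x + y)) - wStar γ s x) (cross3 e1 (wStar γ s x))) = 0 ∧
        Real.sqrt (y ^ 2 + φ ^ 2)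
            + H1norm (fun x => rot (-φ) (w (x + y)) - wStar γ s x)
          ≤ C₁ * H1norm (fun x => w x - wStar γ s x) ∧
        (∀ y' φ' : ℝ,
          ((∫ x : ℝ, dot3 (rot (-φ') (w (x + y')) - wStar γ s x) (deriv (wStar γ s) x)) = 0 ∧
           (∫ x : ℝ, dot3 (rot (-φ') (w (x + y')) - wStar γ s x) (cross3 e1 (wStar γ s x))) = 0 ∧
           Real.sqrt (y' ^ 2 + φ' ^ 2)
               + H1norm (fun x => rot (-φ') (w (x + y')) - wStar γ s x)
             ≤ C₁ * H1norm (fun x => w x - wStar γ s x)) →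
          y' = y ∧ φ' = φ) := by
  set k := Real.sqrt (1 - γ ^ 2) with hkdef
  have hpos : 0 < 1 - γ ^ 2 := by nlinarith [hγ.1, hγ.2]
  have hk : 0 < k := Real.sqrt_pos.2 hpos
  have hk1 : k ≤ 1 := by
    rw [hkdef]; exact Real.sqrt_le_iff.2 ⟨zero_le_one, by nlinarith [sq_nonneg γ]⟩
  have hγ1 : |γ| ≤ 1 := abs_le.2 ⟨hγ.1.le, hγ.2.le⟩
  have hs2 : s ^ 2 = 1 := by rcases hs with rfl | rfl <;> norm_num
  obtain ⟨r, δ, K, hr, hr1, hδ, hK, H⟩ := modulation_aux (γ := γ) (s := s) hk hk1 hγ1 hs2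
  set M := 6 * 26 * Real.exp k * L2norm (rho k) with hM
  have hM0 : 0 ≤ M := mul_nonneg (by positivity) (L2norm_nonneg _)
  set C₁ := 1 + (2 + M) * K with hC
  have hC1 : 1 ≤ C₁ := by
    rw [hC]; nlinarith [mul_nonneg (add_nonneg zero_le_two hM0) hK]
  have hC0 : 0 < C₁ := by linarith
  refine ⟨min δ (r / C₁), C₁, by positivity, hC1, ?_⟩
  have hWeq : wStar γ s = Wf k γ s := wStar_eq γ s
  have hderiv : deriv (wStar γ s) = fun x => Af k γ s x - γ • Bf k γ s x := by
    funext x; rw [hWeq]; exact (Wf_hasDerivAt k γ s x).deriv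
  rw [hderiv]
  simp only [hWeq, cross_e1]
  intro w hwC hwn hu hu' hH1
  have hwc : Continuous w := hwC.continuous
  have hwd : Differentiable ℝ w := hwC.differentiable (by norm_num)
  have hwb : ∀ x, ‖w x‖ ≤ 1 := fun x => (hwn x).le
  have hL2 : L2norm (fun x => w x - Wf k γ s x) ≤ H1norm (fun x => w x - Wf k γ s x) := by
    unfold H1norm; linarith [L2norm_nonneg (deriv (fun x => w x - Wf k γ s x))]
  obtain ⟨⟨p, hp, hpA, hpB, hpn⟩, Huniq⟩ :=
    H w hwc hwb hu (hL2.trans (hH1.trans (min_le_left _ _)))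
  have hr2 : C₁ * H1norm (fun x => w x - Wf k γ s x) ≤ r := by
    have := hH1.trans (min_le_right _ _)
    rw [le_div_iff₀ hC0] at this
    linarith
  have oB : ∀ y φ, (∫ x, dot3 (rot (-φ) (w (x + y)) - Wf k γ s x) (linJ (Wf k γ s x)))
      = FS w (Bf k γ s) (y, φ) := fun y φ =>
    orth_eq_FS w (Wf k γ s) (Bf k γ s) (inner_W_B k γ s) y φ
  have oA : ∀ y φ, (∫ x, dot3 (rot (-φ) (w (x + y)) - Wf k γ s x)
      (Af k γ s x - γ • Bf k γ s x))
      = FS w (Af k γ s) (y, φ) - γ * FS w (Bf k γ s) (y, φ) := by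
    intro y φ
    have h1 := orth_eq_FS w (Wf k γ s) (fun x => (1 : ℝ) • Af k γ s x + (-γ) • Bf k γ s x)
      (fun x => by
        rw [inner_add_right, inner_smul_right, inner_smul_right, inner_W_A hs2, inner_W_B]; ring)
      y φ
    rw [FS_comb hk hwc hwb (Af_dec hk hk1 hs2) (Bf_dec hk hs2)] at h1
    have e : ∀ x, Af k γ s x - γ • Bf k γ s x = (1 : ℝ) • Af k γ s x + (-γ) • Bf k γ s x := by
      intro x; module
    simp only [e]
    rw [h1]; ring
  simp only [oA, oB]
  obtain ⟨y, φ⟩ := p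
  set U := H1norm (fun x => w x - Wf k γ s x) with hU
  have hm1 : ‖(y, φ)‖ ≤ 1 := by
    have : ‖(y, φ)‖ ≤ r := by simpa using hp
    linarith
  have hy : |y| ≤ ‖(y, φ)‖ := norm_fst_le (y, φ)
  have hφ : |φ| ≤ ‖(y, φ)‖ := norm_snd_le (y, φ)
  have hnK : ‖(y, φ)‖ ≤ K * U := hpn.trans (mul_le_mul_of_nonneg_left hL2 hK)
  have d1 := (Wf'_dec hk hk1 hγ1 hs2).mono (show (10 : ℝ) ≤ 26 by norm_num)
  have d2 := Wf''_dec hk hk1 hγ1 hs2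
  have hQ : ∀ x, ‖linQ (Wf k γ s x)‖ ≤ 26 * rho k x := fun x =>
    (Q_Wf_bound hk hs2 x).trans (by linarith [rho_pos k x])
  have hE := H1_part hk (by norm_num) (Wf_hasDerivAt k γ s) d1.bound hQ (Wf'_hasDerivAt k γ s)
    d2.bound hy hφ hm1 hwd hu hu'
  refine ⟨y, φ, ?_, ?_, hpB, ?_, ?_⟩
  · intro x
    have h1 : ‖rot (-φ) (w (x + y))‖ = 1 := by rw [norm_rot, hwn]
    have h2 := norm_Wf hs2 k γ x
    rw [dot3_eq_inner, norm_sub_sq_real, inner_sub_left, real_inner_self_eq_norm_sq, h1, h2]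
    ring
  · rw [hpA, hpB]; ring
  · have hsq : Real.sqrt (y ^ 2 + φ ^ 2) ≤ 2 * ‖(y, φ)‖ := by
      apply Real.sqrt_le_iff.2 ⟨by positivity, ?_⟩
      rw [← sq_abs y, ← sq_abs φ]
      nlinarith [abs_nonneg y, abs_nonneg φ]
    have : (2 + M) * ‖(y, φ)‖ ≤ (2 + M) * (K * U) :=
      mul_le_mul_of_nonneg_left hnK (by linarith)
    rw [hC]
    rw [← hM] at hE
    nlinarith
  · rintro y' φ' ⟨h1, h2, h3⟩
    rw [h2, mul_zero, sub_zero] at h1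
    have h4 : Real.sqrt (y' ^ 2 + φ' ^ 2) ≤ r := by
      linarith [H1norm_nonneg (fun x => rot (-φ') (w (x + y')) - Wf k γ s x)]
    have h5 : (y', φ') ∈ Metric.closedBall (0 : ℝ × ℝ) r := by
      rw [Metric.mem_closedBall, dist_zero_right, Prod.norm_def]
      refine max_le (le_trans ?_ h4) (le_trans ?_ h4)
      · exact Real.abs_le_sqrt (by nlinarith [sq_nonneg φ'])
      · exact Real.abs_le_sqrt (by nlinarith [sq_nonneg y'])
    have := Huniq _ h5 _ hp h1 h2 hpA hpB
    exact ⟨congrArg Prod.fst this, congrArg Prod.snd this⟩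
end
end
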